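/- The polynomials P_{λ,μ} satisfy P_{λ,μ}(e,f) = (−1)^{|λ|+|μ|} · P_{λ*,μ*}(−e,−f), as polynomials in e and f. -/

import Mathlib

open scoped Classical BigOperators
noncomputable section

namespace ChernTensor

/-- The rectangular Young diagram with `r` rows each of length `c`. -/
def rect (r c : ℕ) : YoungDiagram :=
  ⟨Finset.range r ×ˢ Finset.range c, by
    intro p q hle hp
    simp only [Finset.coe_product, Set.mem_prod, Finset.mem_coe, Finset.mem_range] at hp ⊢
    exact ⟨lt_of_le_of_lt hle.1 hp.1, lt_of_le_of_lt hle.2 hp.2⟩⟩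

/-- The complement of a diagram `d` (rotated by 180°) inside the rectangle
with `r` rows and `c` columns. -/
def complIn (r c : ℕ) (d : YoungDiagram) : YoungDiagram :=
  ⟨(Finset.range r ×ˢ Finset.range c).filter
      (fun p => (r - 1 - p.1, c - 1 - p.2) ∉ d), by
    intro p q hle hp
    simp only [Finset.coe_filter, Set.mem_setOf_eq, Finset.mem_product,
      Finset.mem_range] at hp ⊢
    refine ⟨⟨lt_of_le_of_lt hle.1 hp.1.1, lt_of_le_of_lt hle.2 hp.1.2⟩, fun hq => hp.2 ?_⟩
    exact d.isLowerSet (Prod.mk_le_mk.mpr ⟨Nat.sub_le_sub_left hle.1 _,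
      Nat.sub_le_sub_left hle.2 _⟩) hq⟩

/-- The complement `e×f − ν̃ = (e − ν*_f, …, e − ν*_1)` of `ν` in the rectangle
with `f` rows each of length `e` (the paper's `e×f`). -/
def rectCompl (e f : ℕ) (ν : YoungDiagram) : YoungDiagram :=
  complIn f e ν.transpose

/-- The product of the hook lengths of all boxes of a Young diagram, as a rational. -/
def hookProd (ν : YoungDiagram) : ℚ :=
  ∏ c ∈ ν.cells, ((ν.rowLen c.1 + ν.colLen c.2 - c.1 - c.2 - 1 : ℕ) : ℚ)

/-- The content polynomial `(n | ρ) = ∏_{(i,j) ∈ ρ} (n + j − i)` evaluated at `n`. -/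
def contPoly (n : ℚ) (ρ : YoungDiagram) : ℚ :=
  ∏ c ∈ ρ.cells, (n + (c.2 : ℚ) - (c.1 : ℚ))

/-- The skew content polynomial `(n | ρ − σ) = ∏_{(i,j) ∈ ρ/σ} (n + j − i)`. -/
def skewContPoly (n : ℚ) (ρ σ : YoungDiagram) : ℚ :=
  ∏ c ∈ ρ.cells \ σ.cells, (n + (c.2 : ℚ) - (c.1 : ℚ))

/-- `T : ℕ×ℕ → ℕ` is a Littlewood–Richardson skew tableau of shape `ν/λ` and
content `μ`: entries (≥ 1) exactly on the skew cells, rows weakly increasing,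
columns strictly increasing, exactly `μ_k` entries equal to `k` (1-indexed),
and the reverse reading word is a lattice word. -/
def IsLRTableau (lam mu nu : YoungDiagram) (T : ℕ × ℕ → ℕ) : Prop :=
  (∀ c : ℕ × ℕ, c ∈ nu.cells \ lam.cells ↔ T c ≠ 0) ∧
  (∀ i j j', j ≤ j' → (i, j) ∈ nu.cells \ lam.cells → (i, j') ∈ nu.cells \ lam.cells →
    T (i, j) ≤ T (i, j')) ∧
  (∀ i i' j, i < i' → (i, j) ∈ nu.cells \ lam.cells → (i', j) ∈ nu.cells \ lam.cells →
    T (i, j) < T (i', j)) ∧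
  (∀ k : ℕ, ((nu.cells \ lam.cells).filter (fun c => T c = k + 1)).card = mu.rowLen k) ∧
  (∀ c ∈ nu.cells \ lam.cells, ∀ k : ℕ,
    (((nu.cells \ lam.cells).filter
        (fun d => (d.1 < c.1 ∨ (d.1 = c.1 ∧ c.2 ≤ d.2)) ∧ T d = k + 2)).card ≤
     ((nu.cells \ lam.cells).filter
        (fun d => (d.1 < c.1 ∨ (d.1 = c.1 ∧ c.2 ≤ d.2)) ∧ T d = k + 1)).card))

/-- The Littlewood–Richardson coefficient `c^ν_{λμ}`, defined as the number of
Littlewood–Richardson skew tableaux of shape `ν/λ` and content `μ`. -/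
def lrCoeff (lam mu nu : YoungDiagram) : ℕ :=
  if lam ≤ nu then Nat.card {T : ℕ × ℕ → ℕ // IsLRTableau lam mu nu T} else 0

/-- The universal coefficient `P_{λ,μ}(e,f) = ∑_ν c^{ν*}_{λ*,μ} (e|ν−λ)(f|ν*−μ)/h(ν)`. -/
def P (lam mu : YoungDiagram) (e f : ℚ) : ℚ :=
  ∑ᶠ nu : YoungDiagram, (lrCoeff lam.transpose mu nu.transpose : ℚ) *
    skewContPoly e nu lam * skewContPoly f nu.transpose mu / hookProd nu

/-- A semistandard filling of the cells of `lam` with values in `Fin n`: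
weakly increasing along rows, strictly increasing down columns. -/
def IsSSYT (lam : YoungDiagram) {n : ℕ} (T : lam.cells → Fin n) : Prop :=
  (∀ a b : lam.cells, (a : ℕ × ℕ).1 = (b : ℕ × ℕ).1 → (a : ℕ × ℕ).2 ≤ (b : ℕ × ℕ).2 →
    T a ≤ T b) ∧
  (∀ a b : lam.cells, (a : ℕ × ℕ).2 = (b : ℕ × ℕ).2 → (a : ℕ × ℕ).1 < (b : ℕ × ℕ).1 →
    T a < T b)

/-- The Schur polynomial `s_λ(x₁,…,x_n)` evaluated at `x`, as the generating
function of semistandard tableaux. -/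
def schur (lam : YoungDiagram) {n : ℕ} (x : Fin n → ℚ) : ℚ :=
  ∑ᶠ T : {T : lam.cells → Fin n // IsSSYT lam T}, ∏ c : lam.cells, x (T.1 c)

/-- The generalized binomial coefficient `C(a, b) = a(a−1)⋯(a−b+1)/b!`. -/
def gbinom (a : ℚ) (b : ℕ) : ℚ :=
  (∏ i ∈ Finset.range b, (a - i)) / (Nat.factorial b : ℚ)


theorem le_iff_rowLen_le {κ ν : YoungDiagram} : κ ≤ ν ↔ ∀ i, κ.rowLen i ≤ ν.rowLen i := by
  constructor
  · intro h i
    by_contra! hlt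
    have := h (YoungDiagram.mem_iff_lt_rowLen.2 hlt)
    rw [YoungDiagram.mem_iff_lt_rowLen] at this
    exact lt_irrefl _ this
  · rintro h ⟨i, j⟩ hc
    rw [YoungDiagram.mem_iff_lt_rowLen] at hc ⊢
    exact hc.trans_le (h i)

theorem ext_rowLen {κ ν : YoungDiagram} (h : ∀ i, κ.rowLen i = ν.rowLen i) : κ = ν :=
  le_antisymm (le_iff_rowLen_le.2 fun i => (h i).le) (le_iff_rowLen_le.2 fun i => (h i).ge)

/-- The diagram `ν` with its `i`-th row cut down to at most `r i` boxes. -/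
def trim (ν : YoungDiagram) (r : ℕ → ℕ) (hr : Antitone r) : YoungDiagram :=
  ⟨ν.cells.filter fun c => c.2 < r c.1, by
    rintro ⟨i, j⟩ ⟨i', j'⟩ hle hp
    simp only [Finset.coe_filter, Set.mem_ofPred_eq, YoungDiagram.mem_cells] at hp ⊢
    exact ⟨ν.up_left_mem hle.1 hle.2 hp.1, lt_of_le_of_lt hle.2 (hp.2.trans_le (hr hle.1))⟩⟩

theorem mem_trim {ν : YoungDiagram} {r : ℕ → ℕ} {hr : Antitone r} {c : ℕ × ℕ} :
    c ∈ trim ν r hr ↔ c ∈ ν ∧ c.2 < r c.1 := by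
  rw [← YoungDiagram.mem_cells]
  simp [trim]

theorem rowLen_trim {ν : YoungDiagram} {r : ℕ → ℕ} {hr : Antitone r} {i : ℕ}
    (h : r i ≤ ν.rowLen i) : (trim ν r hr).rowLen i = r i := by
  have key : ∀ j, j < (trim ν r hr).rowLen i ↔ j < r i := fun j => by
    rw [← YoungDiagram.mem_iff_lt_rowLen, mem_trim, YoungDiagram.mem_iff_lt_rowLen]
    exact ⟨fun h => h.2, fun h' => ⟨h'.trans_le h, h'⟩⟩
  exact le_antisymm (le_of_forall_lt fun j hj => (key j).1 hj)
    (le_of_forall_lt fun j hj => (key j).2 hj)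

theorem card_eq_sum_rowLen {ν : YoungDiagram} {N : ℕ} (hN : ν.rowLen N = 0) :
    ν.card = ∑ i ∈ Finset.range N, ν.rowLen i := by
  have : ∀ c ∈ ν.cells, c.1 ∈ Finset.range N := by
    rintro ⟨i, j⟩ hc
    rw [YoungDiagram.mem_cells, YoungDiagram.mem_iff_lt_rowLen] at hc
    by_contra hi
    have := ν.rowLen_anti N i (by simpa using hi)
    omega
  rw [YoungDiagram.card, Finset.card_eq_sum_card_fiberwise this]
  exact Finset.sum_congr rfl fun i _ => (ν.rowLen_eq_card).symm

theorem rowLen_colLen_zero (ν : YoungDiagram) : ν.rowLen (ν.colLen 0) = 0 := by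
  by_contra h
  have := YoungDiagram.mem_iff_lt_rowLen.2 (Nat.pos_of_ne_zero h)
  rw [YoungDiagram.mem_iff_lt_colLen] at this
  exact lt_irrefl _ this

theorem rowLen_eq_zero_of_le {ν : YoungDiagram} {N i : ℕ} (hN : ν.rowLen N = 0) (h : N ≤ i) :
    ν.rowLen i = 0 := Nat.le_zero.1 (hN ▸ ν.rowLen_anti N i h)

theorem rowLen_bot (i : ℕ) : (⊥ : YoungDiagram).rowLen i = 0 := by
  by_contra h
  exact YoungDiagram.notMem_bot _ (YoungDiagram.mem_iff_lt_rowLen.2 (Nat.pos_of_ne_zero h))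

theorem card_transpose (ν : YoungDiagram) : ν.transpose.card = ν.card := by
  simp [YoungDiagram.card, YoungDiagram.transpose]

theorem card_le_card {κ ν : YoungDiagram} (h : κ ≤ ν) : κ.card ≤ ν.card :=
  Finset.card_le_card (YoungDiagram.cells_subset_iff.2 h)

/-- `ν / κ` is a horizontal strip. -/
def IsHStrip (κ ν : YoungDiagram) : Prop :=
  ∀ i, κ.rowLen i ≤ ν.rowLen i ∧ ν.rowLen (i + 1) ≤ κ.rowLen i

theorem IsHStrip.le {κ ν : YoungDiagram} (h : IsHStrip κ ν) : κ ≤ ν :=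
  le_iff_rowLen_le.2 fun i => (h i).1

theorem isHStrip_transpose_iff {κ ν : YoungDiagram} : IsHStrip κ.transpose ν.transpose ↔
    ∀ i, κ.rowLen i ≤ ν.rowLen i ∧ ν.rowLen i ≤ κ.rowLen i + 1 := by
  constructor
  · intro h
    have hle := le_iff_rowLen_le.1 (YoungDiagram.transpose_le_iff.1 h.le)
    refine fun i => ⟨hle i, ?_⟩
    by_contra! hlt
    have h1 := (h (κ.rowLen i)).2
    rw [YoungDiagram.rowLen_transpose, YoungDiagram.rowLen_transpose] at h1
    have h2 := YoungDiagram.mem_iff_lt_colLen.1 (YoungDiagram.mem_iff_lt_rowLen.2 hlt)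
    have h3 := YoungDiagram.mem_iff_lt_rowLen.1
      (YoungDiagram.mem_iff_lt_colLen.2 (h2.trans_le h1))
    exact lt_irrefl _ h3
  · intro h
    have hle := le_iff_rowLen_le.1 (YoungDiagram.transpose_le_iff.2
      (le_iff_rowLen_le.2 fun i => (h i).1))
    refine fun j => ⟨hle j, ?_⟩
    rw [YoungDiagram.rowLen_transpose, YoungDiagram.rowLen_transpose]
    refine le_of_forall_lt fun i hi => ?_
    rw [← YoungDiagram.mem_iff_lt_colLen, YoungDiagram.mem_iff_lt_rowLen] at hi ⊢
    have := (h i).2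
    omega

theorem finite_setOf_le (ν : YoungDiagram) : {κ : YoungDiagram | κ ≤ ν}.Finite := by
  refine Set.Finite.of_finite_image (f := YoungDiagram.cells)
    ((ν.cells.powerset.finite_toSet).subset ?_) fun κ _ κ' _ h => YoungDiagram.ext h
  rintro _ ⟨κ, hκ, rfl⟩
  simpa using YoungDiagram.cells_subset_iff.2 hκ

/-- The diagrams obtained from `ν` by removing a horizontal strip. -/
def hStrips (ν : YoungDiagram) : Finset YoungDiagram :=
  (finite_setOf_le ν).toFinset.filter fun κ => IsHStrip κ ν

theorem mem_hStrips {κ ν : YoungDiagram} : κ ∈ hStrips ν ↔ IsHStrip κ ν := by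
  simpa [hStrips] using IsHStrip.le

/-- The operator on functions of diagrams that sums over the removals of a horizontal strip of
size `k`. -/
def hOp (k : ℤ) : Module.End ℤ (YoungDiagram → ℤ) where
  toFun f ν := ∑ κ ∈ (hStrips ν).filter fun κ => (ν.card : ℤ) = κ.card + k, f κ
  map_add' f g := by ext ν; simp [Finset.sum_add_distrib]
  map_smul' c f := by ext ν; simp [Finset.mul_sum]

theorem hOp_apply (k : ℤ) (f : YoungDiagram → ℤ) (ν : YoungDiagram) :
    hOp k f ν = ∑ κ ∈ (hStrips ν).filter fun κ => (ν.card : ℤ) = κ.card + k, f κ := rfl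

/-- Conjugation of functions on diagrams. -/
def conj : Module.End ℤ (YoungDiagram → ℤ) where
  toFun f ν := f ν.transpose
  map_add' _ _ := rfl
  map_smul' _ _ := rfl

theorem conj_apply (f : YoungDiagram → ℤ) (ν : YoungDiagram) : conj f ν = f ν.transpose := rfl

theorem conj_mul_conj : conj * conj = 1 := by
  ext f ν
  simp [conj_apply]

/-- The operator that sums over the removals of a vertical strip of size `k`. -/
def eOp (k : ℤ) : Module.End ℤ (YoungDiagram → ℤ) := conj * hOp k * conj

theorem eOp_apply (k : ℤ) (f : YoungDiagram → ℤ) (ν : YoungDiagram) :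
    eOp k f ν = ∑ κ ∈ ((finite_setOf_le ν).toFinset.filter fun κ =>
      IsHStrip κ.transpose ν.transpose ∧ (ν.card : ℤ) = κ.card + k), f κ := by
  simp only [eOp, Module.End.mul_apply, conj_apply, hOp_apply]
  refine Finset.sum_nbij' YoungDiagram.transpose YoungDiagram.transpose ?_ ?_ ?_ ?_ ?_
  · intro κ hκ
    simp only [Finset.mem_filter, mem_hStrips, card_transpose, Set.Finite.mem_toFinset,
      Set.mem_ofPred_eq, YoungDiagram.transpose_transpose] at hκ ⊢
    exact ⟨YoungDiagram.transpose_le_iff.1 (by simpa using hκ.1.le), hκ⟩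
  · intro κ hκ
    simp only [Finset.mem_filter, mem_hStrips, card_transpose, Set.Finite.mem_toFinset,
      Set.mem_ofPred_eq] at hκ ⊢
    exact hκ.2
  all_goals simp

/-- Reflection of the row lengths of `c` in the intervals allowed by the interlacing conditions
`b ≤ c ≤ a`, from row `i₀` on, where in row `i₀` the interval is cut down to end at `j`. -/
def toggleRow (b c a : YoungDiagram) (i₀ j i : ℕ) : ℕ :=
  if i < i₀ then c.rowLen i
  else (if i = i₀ then j else min (a.rowLen i) (b.rowLen (i - 1))) +
    max (a.rowLen (i + 1)) (b.rowLen i) - c.rowLen i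

/-- The (partial) Bender–Knuth involution on the middle diagram of two consecutive horizontal
strips. -/
def toggle (b c a : YoungDiagram) (i₀ j : ℕ) : YoungDiagram :=
  if h : Antitone (toggleRow b c a i₀ j) then trim a _ h else c

/-- The assumptions under which `toggle b c a i₀ j` is well behaved. -/
structure Togglable (b c a : YoungDiagram) (i₀ j : ℕ) : Prop where
  left : IsHStrip b c
  right : IsHStrip c a
  rowLen_le : c.rowLen i₀ ≤ j
  le_rowLen : j ≤ a.rowLen i₀
  le_rowLen_pred : ∀ i, i + 1 = i₀ → j ≤ b.rowLen i

namespace Togglable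

variable {b c a : YoungDiagram} {i₀ j : ℕ}

theorem toggleRow_bounds (h : Togglable b c a i₀ j) (i : ℕ) :
    toggleRow b c a i₀ j i ≤ a.rowLen i ∧ b.rowLen i ≤ toggleRow b c a i₀ j i ∧
      a.rowLen (i + 1) ≤ toggleRow b c a i₀ j i ∧ toggleRow b c a i₀ j (i + 1) ≤ b.rowLen i := by
  obtain ⟨h1, h2, h3, h4, h5⟩ := h
  have h1i := h1 i
  have h2i := h2 i
  have h1s := h1 (i + 1)
  have h2s := h2 (i + 1)
  have h1p := h1 (i - 1)
  have h2p := h2 (i - 1)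
  have h5i := h5 i
  have h5p := h5 (i - 1)
  simp only [toggleRow, Nat.add_sub_cancel]
  rcases lt_trichotomy i i₀ with hi | rfl | hi
  · rw [if_pos hi]
    rcases (Nat.add_one_le_of_lt hi).eq_or_lt with rfl | hi'
    · have h6 := h5i rfl
      simp only [lt_irrefl, if_false, if_true]
      omega
    · rw [if_pos hi']
      omega
  · simp only [lt_irrefl, if_false, if_true, Nat.not_succ_lt_self, Nat.succ_ne_self]
    omega
  · obtain ⟨m, rfl⟩ : ∃ m, i = m + 1 := ⟨i - 1, by omega⟩
    simp only [Nat.add_sub_cancel] at *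
    rw [if_neg (by omega), if_neg (by omega), if_neg (by omega), if_neg (by omega)]
    omega

theorem rowLen_toggle (h : Togglable b c a i₀ j) (i : ℕ) :
    (toggle b c a i₀ j).rowLen i = toggleRow b c a i₀ j i := by
  have hanti : Antitone (toggleRow b c a i₀ j) := antitone_nat_of_succ_le fun i =>
    (h.toggleRow_bounds i).2.2.2.trans (h.toggleRow_bounds i).2.1
  rw [toggle, dif_pos hanti, rowLen_trim (h.toggleRow_bounds i).1]

theorem rowLen_toggle_of_lt (h : Togglable b c a i₀ j) {i : ℕ} (hi : i < i₀) :
    (toggle b c a i₀ j).rowLen i = c.rowLen i := by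
  rw [h.rowLen_toggle, toggleRow, if_pos hi]

theorem rowLen_toggle_le (h : Togglable b c a i₀ j) : (toggle b c a i₀ j).rowLen i₀ ≤ j := by
  rw [h.rowLen_toggle, toggleRow, if_neg (lt_irrefl _), if_pos rfl]
  have h1 := h.left i₀
  have h2 := h.right i₀
  omega

theorem toggle (h : Togglable b c a i₀ j) : Togglable b (toggle b c a i₀ j) a i₀ j where
  left i := by
    rw [h.rowLen_toggle, h.rowLen_toggle]
    have := h.toggleRow_bounds i
    omega
  right i := by
    rw [h.rowLen_toggle]
    have := h.toggleRow_bounds i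
    omega
  rowLen_le := h.rowLen_toggle_le
  le_rowLen := h.le_rowLen
  le_rowLen_pred := h.le_rowLen_pred

theorem toggle_toggle (h : Togglable b c a i₀ j) :
    ChernTensor.toggle b (ChernTensor.toggle b c a i₀ j) a i₀ j = c := by
  refine ext_rowLen fun i => ?_
  rw [h.toggle.rowLen_toggle]
  have h1 := h.left i
  have h2 := h.right i
  have h1p := h.left (i - 1)
  have h2p := h.right (i - 1)
  have h3 := h.rowLen_le
  rcases lt_trichotomy i i₀ with hi | rfl | hi
  · rw [toggleRow, if_pos hi, h.rowLen_toggle_of_lt hi]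
  · rw [toggleRow, h.rowLen_toggle, toggleRow]
    simp only [lt_irrefl, if_false, if_true]
    omega
  · obtain ⟨m, rfl⟩ : ∃ m, i = m + 1 := ⟨i - 1, by omega⟩
    rw [toggleRow, h.rowLen_toggle, toggleRow]
    simp only [Nat.add_sub_cancel] at *
    rw [if_neg (by omega), if_neg (by omega), if_neg (by omega)]
    omega

theorem sum_rowLen_toggle (h : Togglable b c a i₀ j) {N : ℕ} (hN : i₀ ≤ N) :
    ∑ i ∈ Finset.range (N + 1), (ChernTensor.toggle b c a i₀ j).rowLen i +
        ∑ i ∈ Finset.range (N + 1), c.rowLen i + ∑ i ∈ Finset.range (i₀ + 1), a.rowLen i +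
        ∑ i ∈ Finset.range i₀, b.rowLen i =
      2 * ∑ i ∈ Finset.range i₀, c.rowLen i + j + ∑ i ∈ Finset.range (N + 1), a.rowLen i +
        ∑ i ∈ Finset.range N, b.rowLen i + max (a.rowLen (N + 1)) (b.rowLen N) := by
  induction N, hN using Nat.le_induction with
  | base =>
    rw [Finset.sum_range_succ, Finset.sum_congr rfl fun i hi =>
      h.rowLen_toggle_of_lt (Finset.mem_range.1 hi), Finset.sum_range_succ _ i₀,
      h.rowLen_toggle, toggleRow]
    simp only [lt_irrefl, if_false, if_true]
    have h1 := h.left i₀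
    have h2 := h.right i₀
    have h3 := h.rowLen_le
    omega
  | succ N hN ih =>
    rw [Finset.sum_range_succ, Finset.sum_range_succ (fun i => c.rowLen i) (N + 1),
      Finset.sum_range_succ (fun i => a.rowLen i) (N + 1),
      Finset.sum_range_succ (fun i => b.rowLen i) N,
      h.rowLen_toggle (N + 1), toggleRow, if_neg (by omega), if_neg (by omega), Nat.add_sub_cancel]
    have h1 := h.left (N + 1)
    have h2 := h.right (N + 1)
    have h1' := h.left N
    have h2' := h.right N
    omega

theorem card_toggle (h : Togglable b c a i₀ j) :
    (ChernTensor.toggle b c a i₀ j).card + c.card + ∑ i ∈ Finset.range (i₀ + 1), a.rowLen i +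
        ∑ i ∈ Finset.range i₀, b.rowLen i =
      2 * ∑ i ∈ Finset.range i₀, c.rowLen i + j + a.card + b.card := by
  set N := max i₀ (a.colLen 0) with hN
  have haN : a.rowLen N = 0 := rowLen_eq_zero_of_le (rowLen_colLen_zero a) (le_max_right _ _)
  have hcN : c.rowLen N = 0 := by have := h.right N; omega
  have hbN : b.rowLen N = 0 := by have := h.left N; omega
  have hdN : (ChernTensor.toggle b c a i₀ j).rowLen N = 0 := by have := h.toggle.right N; omega
  have haN' := rowLen_eq_zero_of_le haN (Nat.le_succ N)
  rw [card_eq_sum_rowLen haN', card_eq_sum_rowLen hbN,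
    card_eq_sum_rowLen (rowLen_eq_zero_of_le hcN (Nat.le_succ N)),
    card_eq_sum_rowLen (rowLen_eq_zero_of_le hdN (Nat.le_succ N))]
  have := h.sum_rowLen_toggle (le_max_left i₀ (a.colLen 0))
  rw [← hN] at this
  simp only [Nat.succ_eq_add_one] at *
  omega

end Togglable

theorem IsHStrip.togglable {b c a : YoungDiagram} (h : IsHStrip b c) (h' : IsHStrip c a) :
    Togglable b c a 0 (a.rowLen 0) :=
  ⟨h, h', (h' 0).1, le_rfl, by simp⟩

theorem hOp_mul_apply (k l : ℤ) (f : YoungDiagram → ℤ) (ν : YoungDiagram) :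
    (hOp k * hOp l) f ν = ∑ p ∈ ((finite_setOf_le ν).toFinset ×ˢ (finite_setOf_le ν).toFinset).filter
      (fun p => (IsHStrip p.1 ν ∧ (ν.card : ℤ) = p.1.card + k) ∧
        (IsHStrip p.2 p.1 ∧ (p.1.card : ℤ) = p.2.card + l)), f p.2 := by
  simp only [Module.End.mul_apply, hOp_apply]
  rw [Finset.sum_sigma']
  refine Finset.sum_nbij' (fun p => (p.1, p.2)) (fun p => ⟨p.1, p.2⟩) ?_ ?_ ?_ ?_ ?_
  · rintro ⟨κ, lam⟩ h
    simp only [Finset.mem_sigma, Finset.mem_filter, mem_hStrips, Finset.mem_product,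
      Set.Finite.mem_toFinset, Set.mem_ofPred_eq] at h ⊢
    exact ⟨⟨h.1.1.le, h.2.1.le.trans h.1.1.le⟩, h⟩
  · rintro ⟨κ, lam⟩ h
    simp only [Finset.mem_sigma, Finset.mem_filter, mem_hStrips, Finset.mem_product] at h ⊢
    exact h.2
  all_goals simp

theorem hOp_commute (k l : ℤ) : Commute (hOp k) (hOp l) := by
  ext f ν
  rw [hOp_mul_apply, hOp_mul_apply]
  have key : ∀ k l : ℤ, ∀ p ∈ ((finite_setOf_le ν).toFinset ×ˢ (finite_setOf_le ν).toFinset).filter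
      (fun p => (IsHStrip p.1 ν ∧ (ν.card : ℤ) = p.1.card + k) ∧
        (IsHStrip p.2 p.1 ∧ (p.1.card : ℤ) = p.2.card + l)),
      (toggle p.2 p.1 ν 0 (ν.rowLen 0), p.2) ∈
        ((finite_setOf_le ν).toFinset ×ˢ (finite_setOf_le ν).toFinset).filter
      (fun p => (IsHStrip p.1 ν ∧ (ν.card : ℤ) = p.1.card + l) ∧
        (IsHStrip p.2 p.1 ∧ (p.1.card : ℤ) = p.2.card + k)) := by
    rintro k l ⟨κ, lam⟩ h
    simp only [Finset.mem_filter, Finset.mem_product,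
      Set.Finite.mem_toFinset, Set.mem_ofPred_eq] at h ⊢
    have ht := h.2.2.1.togglable h.2.1.1
    have hc := ht.card_toggle
    simp only [Finset.sum_range_one, Finset.sum_range_zero, zero_add] at hc
    refine ⟨⟨ht.toggle.right.le, h.1.2⟩, ⟨ht.toggle.right, ?_⟩, ht.toggle.left, ?_⟩ <;> omega
  refine Finset.sum_nbij' (fun p => (toggle p.2 p.1 ν 0 (ν.rowLen 0), p.2))
    (fun p => (toggle p.2 p.1 ν 0 (ν.rowLen 0), p.2)) (key k l) (key l k) ?_ ?_ ?_
  · rintro ⟨κ, lam⟩ h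
    simp only [Finset.mem_filter] at h
    simp only [(h.2.2.1.togglable h.2.1.1).toggle_toggle]
  · rintro ⟨κ, lam⟩ h
    simp only [Finset.mem_filter] at h
    simp only [(h.2.2.1.togglable h.2.1.1).toggle_toggle]
  · intros; rfl

/-- The set of pairs of diagrams obtained from `ν` by first removing a horizontal, then a vertical
strip, of total size `n`. -/
def hvStrips (n : ℕ) (ν : YoungDiagram) : Finset (YoungDiagram × YoungDiagram) :=
  ((finite_setOf_le ν).toFinset ×ˢ (finite_setOf_le ν).toFinset).filter
    fun p => IsHStrip p.1 ν ∧ IsHStrip p.2.transpose p.1.transpose ∧ ν.card = p.2.card + n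

theorem mem_hvStrips {n : ℕ} {ν : YoungDiagram} {p : YoungDiagram × YoungDiagram} :
    p ∈ hvStrips n ν ↔
      IsHStrip p.1 ν ∧ IsHStrip p.2.transpose p.1.transpose ∧ ν.card = p.2.card + n := by
  simp only [hvStrips, Finset.mem_filter, Finset.mem_product,
      Set.Finite.mem_toFinset, Set.mem_ofPred_eq, and_iff_right_iff_imp]
  exact fun h => ⟨h.1.le, (YoungDiagram.transpose_le_iff.1 h.2.1.le).trans h.1.le⟩

theorem sum_hOp_mul_eOp_apply (n : ℕ) (f : YoungDiagram → ℤ) (ν : YoungDiagram) :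
    (∑ k ∈ Finset.range (n + 1), (-1 : ℤ) ^ k • (hOp ((n - k : ℕ) : ℤ) * eOp k)) f ν =
      ∑ p ∈ hvStrips n ν, (-1 : ℤ) ^ (p.1.card - p.2.card) * f p.2 := by
  rw [LinearMap.sum_apply, Finset.sum_apply]
  simp only [LinearMap.smul_apply, Pi.smul_apply, Module.End.mul_apply, hOp_apply, eOp_apply,
    smul_eq_mul, Finset.mul_sum]
  rw [Finset.sum_sigma', Finset.sum_sigma']
  refine Finset.sum_bij' (fun p _ => (p.1.2, p.2))
    (fun p _ => ⟨⟨p.1.card - p.2.card, p.1⟩, p.2⟩) ?_ ?_ ?_ ?_ ?_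
  · rintro ⟨⟨k, κ⟩, lam⟩ h
    simp only [Finset.mem_sigma, Finset.mem_range, Finset.mem_filter, mem_hStrips, mem_hvStrips,
      Set.Finite.mem_toFinset, Set.mem_ofPred_eq] at h ⊢
    exact ⟨h.1.2.1, h.2.2.1, by omega⟩
  · rintro ⟨κ, lam⟩ h
    rw [mem_hvStrips] at h
    have h1 := card_le_card h.1.le
    have hle := YoungDiagram.transpose_le_iff.1 h.2.1.le
    have h2 := card_le_card hle
    simp only [Finset.mem_sigma, Finset.mem_range, Finset.mem_filter, mem_hStrips,
      Set.Finite.mem_toFinset, Set.mem_ofPred_eq] at h h1 h2 ⊢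
    refine ⟨⟨?_, h.1, ?_⟩, hle, h.2.1, ?_⟩ <;> omega
  · rintro ⟨⟨k, κ⟩, lam⟩ h
    simp only [Finset.mem_sigma, Finset.mem_range, Finset.mem_filter] at h ⊢
    have : κ.card - lam.card = k := by omega
    rw [this]
  · rintro ⟨κ, lam⟩ h
    rfl
  · rintro ⟨⟨k, κ⟩, lam⟩ h
    simp only [Finset.mem_sigma, Finset.mem_range, Finset.mem_filter] at h ⊢
    have : κ.card - lam.card = k := by omega
    rw [this]

/-- The diagram `κ ≤ ν` with the length of its `i`-th row changed to `v`. -/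
def updateRow (ν κ : YoungDiagram) (i v : ℕ) : YoungDiagram :=
  if h : Antitone (Function.update κ.rowLen i v) then trim ν _ h else κ

theorem rowLen_updateRow {ν κ : YoungDiagram} {i v : ℕ} (hκ : κ ≤ ν) (hv : v ≤ ν.rowLen i)
    (h₁ : κ.rowLen (i + 1) ≤ v) (h₂ : ∀ m, m + 1 = i → v ≤ κ.rowLen m) (m : ℕ) :
    (updateRow ν κ i v).rowLen m = if m = i then v else κ.rowLen m := by
  have hanti : Antitone (Function.update κ.rowLen i v) := by
    refine antitone_nat_of_succ_le fun m => ?_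
    simp only [Function.update_apply]
    have := κ.rowLen_anti m (m + 1) (Nat.le_succ m)
    split_ifs with h h' h'
    · omega
    · exact h₂ m h
    · subst h'; exact h₁
    · exact this
  rw [updateRow, dif_pos hanti, rowLen_trim, Function.update_apply]
  rw [Function.update_apply]
  split_ifs with h
  · subst h; exact hv
  · exact le_iff_rowLen_le.1 hκ m

theorem card_updateRow {ν κ : YoungDiagram} {i v : ℕ} (hκ : κ ≤ ν) (hv : v ≤ ν.rowLen i)
    (h₁ : κ.rowLen (i + 1) ≤ v) (h₂ : ∀ m, m + 1 = i → v ≤ κ.rowLen m) :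
    (updateRow ν κ i v).card + κ.rowLen i = κ.card + v := by
  have hr := rowLen_updateRow hκ hv h₁ h₂
  set N := max (i + 1) (κ.colLen 0) with hN
  have hiN : i < N := lt_of_lt_of_le (Nat.lt_succ_self i) (le_max_left _ _)
  have hκN : κ.rowLen N = 0 := rowLen_eq_zero_of_le (rowLen_colLen_zero κ) (le_max_right _ _)
  have hN' : (updateRow ν κ i v).rowLen N = 0 := by rw [hr, if_neg hiN.ne', hκN]
  have hsum : ∑ m ∈ (Finset.range N).erase i, (updateRow ν κ i v).rowLen m =
      ∑ m ∈ (Finset.range N).erase i, κ.rowLen m :=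
    Finset.sum_congr rfl fun m hm => (hr m).trans (if_neg (Finset.ne_of_mem_erase hm))
  rw [card_eq_sum_rowLen hκN, card_eq_sum_rowLen hN',
    ← Finset.add_sum_erase _ _ (Finset.mem_range.2 hiN),
    ← Finset.add_sum_erase (Finset.range N) (fun m => κ.rowLen m) (Finset.mem_range.2 hiN),
    hsum, hr, if_pos rfl]
  omega

/-- The last row in which `lam ≤ ν` differ. -/
def lastRow (lam ν : YoungDiagram) : ℕ :=
  Nat.findGreatest (fun i => lam.rowLen i < ν.rowLen i) (ν.colLen 0)

theorem lastRow_spec {lam ν : YoungDiagram} (hle : lam ≤ ν) (hne : lam ≠ ν) :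
    lam.rowLen (lastRow lam ν) < ν.rowLen (lastRow lam ν) ∧
      ∀ i, lastRow lam ν < i → lam.rowLen i = ν.rowLen i := by
  obtain ⟨i, hi⟩ : ∃ i, lam.rowLen i < ν.rowLen i := by
    by_contra! h
    exact hne (ext_rowLen fun i => le_antisymm (le_iff_rowLen_le.1 hle i) (h i))
  have hlt : ∀ i, lam.rowLen i < ν.rowLen i → i ≤ ν.colLen 0 := fun i hi => by
    by_contra! h
    have := rowLen_eq_zero_of_le (rowLen_colLen_zero ν) h.le
    omega
  refine ⟨Nat.findGreatest_spec (P := fun i => lam.rowLen i < ν.rowLen i) (hlt i hi) hi,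
    fun m hm => le_antisymm (le_iff_rowLen_le.1 hle m) ?_⟩
  by_contra! h
  exact Nat.findGreatest_is_greatest hm (hlt m h) h

/-- Moving the last free box between the vertical and the horizontal strip. -/
def flipLast (ν : YoungDiagram) (p : YoungDiagram × YoungDiagram) : YoungDiagram × YoungDiagram :=
  (updateRow ν p.1 (lastRow p.2 ν)
    (2 * p.2.rowLen (lastRow p.2 ν) + 1 - p.1.rowLen (lastRow p.2 ν)), p.2)

theorem sum_hvStrips_eq_zero {n : ℕ} (hn : n ≠ 0) (ν : YoungDiagram) (f : YoungDiagram → ℤ) :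
    ∑ p ∈ hvStrips n ν, (-1 : ℤ) ^ (p.1.card - p.2.card) * f p.2 = 0 := by
  have key : ∀ p ∈ hvStrips n ν, flipLast ν p ∈ hvStrips n ν ∧
      flipLast ν (flipLast ν p) = p ∧
      ((flipLast ν p).1.card = p.1.card + 1 ∨ (flipLast ν p).1.card + 1 = p.1.card) := by
    rintro ⟨κ, lam⟩ hp
    rw [mem_hvStrips, isHStrip_transpose_iff] at hp
    obtain ⟨h1, h2, h3⟩ := hp
    dsimp only at h1 h2 h3
    have hle : lam ≤ ν := (le_iff_rowLen_le.2 fun i => (h2 i).1).trans h1.le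
    have hne : lam ≠ ν := by rintro rfl; omega
    obtain ⟨hi1, hi2⟩ := lastRow_spec hle hne
    obtain ⟨κ', hκ'⟩ : ∃ κ', κ' = (flipLast ν (κ, lam)).1 := ⟨_, rfl⟩
    simp only [flipLast] at *
    set i := lastRow lam ν
    have hs := hi2 (i + 1) (Nat.lt_succ_self i)
    have hanti := lam.rowLen_anti i (i + 1) (Nat.le_succ i)
    have a2 := h2 i
    have a1 := h1 i
    have a1' := h1 (i + 1)
    have b1 : 2 * lam.rowLen i + 1 - κ.rowLen i ≤ ν.rowLen i := by omega
    have b2 : κ.rowLen (i + 1) ≤ 2 * lam.rowLen i + 1 - κ.rowLen i := by omega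
    have b3 : ∀ m, m + 1 = i → 2 * lam.rowLen i + 1 - κ.rowLen i ≤ κ.rowLen m := by
      intro m hm
      have := (h1 m).2
      rw [hm] at this
      omega
    have hr := rowLen_updateRow h1.le b1 b2 b3
    have hc := card_updateRow h1.le b1 b2 b3
    have hH : IsHStrip (updateRow ν κ i (2 * lam.rowLen i + 1 - κ.rowLen i)) ν := by
      intro m
      rw [hr]
      have := h1 m
      split_ifs with h
      · subst h; omega
      · exact this
    refine ⟨?_, ?_, ?_⟩
    · rw [mem_hvStrips, isHStrip_transpose_iff]
      refine ⟨hH, fun m => ?_, h3⟩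
      dsimp only
      rw [hr]
      have := h2 m
      split_ifs with h
      · subst h; omega
      · exact this
    · rw [Prod.mk.injEq]
      refine ⟨ext_rowLen fun m => ?_, rfl⟩
      rw [rowLen_updateRow hH.le, hr, hr, if_pos rfl]
      · split_ifs with h
        · subst h; omega
        · rfl
      · rw [hr, if_pos rfl]; omega
      · rw [hr, hr, if_pos rfl, if_neg (Nat.succ_ne_self i)]; omega
      · intro m hm
        rw [hr, hr, if_pos rfl, if_neg (by omega)]
        have := (h1 m).2
        rw [hm] at this
        omega
    · omega
  refine Finset.sum_involution (fun p _ => flipLast ν p) ?_ ?_ (fun p hp => (key p hp).1)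
    (fun p hp => (key p hp).2.1)
  · intro p hp
    obtain ⟨hmem, -, hc⟩ := key p hp
    rw [mem_hvStrips] at hp hmem
    have l1 := card_le_card (YoungDiagram.transpose_le_iff.1 hp.2.1.le)
    have l2 := card_le_card (YoungDiagram.transpose_le_iff.1 hmem.2.1.le)
    change _ + (-1 : ℤ) ^ ((flipLast ν p).1.card - p.2.card) * f p.2 = 0
    change p.2.card ≤ _ at l2
    rcases hc with hc | hc
    · rw [hc, Nat.sub_add_comm l1, pow_succ]; ring
    · rw [← hc, Nat.sub_add_comm l2, pow_succ]; ring
  · intro p hp _ h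
    have := (key p hp).2.2
    rw [h] at this
    omega

theorem hOp_zero : hOp 0 = 1 := by
  ext f ν
  rw [hOp_apply, Finset.sum_eq_single ν]
  · rfl
  · intro κ hκ hne
    simp only [Finset.mem_filter, mem_hStrips] at hκ
    refine absurd (YoungDiagram.ext (Finset.eq_of_subset_of_card_le
      (YoungDiagram.cells_subset_iff.2 hκ.1.le) ?_)) hne
    have := hκ.2
    rw [YoungDiagram.card, YoungDiagram.card] at this
    omega
  · intro h
    refine absurd (Finset.mem_filter.2 ⟨mem_hStrips.2 fun i => ⟨le_rfl, ?_⟩, by simp⟩) h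
    exact ν.rowLen_anti _ _ (Nat.le_succ i)

theorem eOp_zero : eOp 0 = 1 := by
  rw [eOp, hOp_zero, mul_one, conj_mul_conj]

theorem sum_hOp_mul_eOp {n : ℕ} (hn : n ≠ 0) :
    ∑ k ∈ Finset.range (n + 1), (-1 : ℤ) ^ k • (hOp ((n - k : ℕ) : ℤ) * eOp k) = 0 := by
  ext f ν
  rw [sum_hOp_mul_eOp_apply, sum_hvStrips_eq_zero hn]
  rfl

theorem hOp_of_neg {k : ℤ} (hk : k < 0) : hOp k = 0 := by
  ext f ν
  rw [hOp_apply, Finset.sum_eq_zero]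
  · rfl
  · intro κ hκ
    simp only [Finset.mem_filter, mem_hStrips] at hκ
    have := card_le_card hκ.1.le
    omega

theorem hOp_commute_eOp_nat (l : ℤ) (n : ℕ) : Commute (hOp l) (eOp n) := by
  induction n using Nat.strong_induction_on with
  | _ n ih =>
    rcases eq_or_ne n 0 with rfl | hn
    · rw [Nat.cast_zero, eOp_zero]
      exact Commute.one_right _
    · have h := sum_hOp_mul_eOp hn
      rw [Finset.sum_range_succ, Nat.sub_self, Nat.cast_zero, hOp_zero, one_mul] at h
      have hcomm : Commute (hOp l) ((-1 : ℤ) ^ n • eOp n) := by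
        rw [eq_neg_of_add_eq_zero_right h]
        refine (Commute.sum_right _ _ _ fun k hk => ?_).neg_right
        exact ((hOp_commute l _).mul_right (ih k (Finset.mem_range.1 hk))).smul_right _
      have := hcomm.smul_right ((-1 : ℤ) ^ n)
      rwa [smul_smul, ← mul_pow, neg_one_mul, neg_neg, one_pow, one_smul] at this

theorem hOp_commute_eOp (l k : ℤ) : Commute (hOp l) (eOp k) := by
  rcases lt_or_ge k 0 with hk | hk
  · rw [eOp, hOp_of_neg hk, mul_zero, zero_mul]
    exact Commute.zero_right _
  · lift k to ℕ using hk
    exact hOp_commute_eOp_nat l k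

/-- The composition of the operators `hOp (α k)` for `k < n`. -/
def hWord (α : ℕ → ℤ) : ℕ → Module.End ℤ (YoungDiagram → ℤ)
  | 0 => 1
  | n + 1 => hOp (α n) * hWord α n

/-- Chains of diagrams ending with `ν` from index `n` on, with consecutive differences horizontal
strips. These encode skew semistandard tableaux with entries less than `n`. -/
def IsPath (n : ℕ) (ν : YoungDiagram) (C : ℕ → YoungDiagram) : Prop :=
  (∀ k, IsHStrip (C k) (C (k + 1))) ∧ ∀ k, n ≤ k → C k = ν

/-- The finite set of chains satisfying `IsPath`. -/
def paths : ℕ → YoungDiagram → Finset (ℕ → YoungDiagram)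
  | 0, ν => {fun _ => ν}
  | n + 1, ν => (hStrips ν).biUnion fun κ =>
      (paths n κ).image fun C k => if k ≤ n then C k else ν

theorem isHStrip_refl (ν : YoungDiagram) : IsHStrip ν ν :=
  fun i => ⟨le_rfl, ν.rowLen_anti _ _ (Nat.le_succ i)⟩

theorem mem_paths {n : ℕ} {ν : YoungDiagram} {C : ℕ → YoungDiagram} :
    C ∈ paths n ν ↔ IsPath n ν C := by
  induction n generalizing ν C with
  | zero =>
    rw [paths, Finset.mem_singleton]
    constructor
    · rintro rfl
      exact ⟨fun _ => isHStrip_refl ν, fun _ _ => rfl⟩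
    · exact fun h => funext fun k => h.2 k (Nat.zero_le k)
  | succ n ih =>
    simp only [paths, Finset.mem_biUnion, Finset.mem_image, mem_hStrips, ih]
    constructor
    · rintro ⟨κ, hκ, C, hC, rfl⟩
      refine ⟨fun k => ?_, fun k hk => if_neg (by omega)⟩
      beta_reduce
      rcases lt_trichotomy k n with hk | rfl | hk
      · rw [if_pos hk.le, if_pos (by omega)]
        exact hC.1 k
      · rw [if_pos le_rfl, if_neg (by omega), hC.2 k le_rfl]
        exact hκ
      · rw [if_neg (by omega), if_neg (by omega)]
        exact isHStrip_refl ν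
    · intro h
      have hn : IsHStrip (C n) ν := by
        rw [← h.2 (n + 1) le_rfl]
        exact h.1 n
      refine ⟨C n, hn, fun k => if k ≤ n then C k else C n, ⟨fun k => ?_, fun k hk => ?_⟩, ?_⟩
      · beta_reduce
        rcases lt_or_ge k n with hk | hk
        · rw [if_pos hk.le, if_pos (by omega)]
          exact h.1 k
        · have hm : ∀ m, n ≤ m → (if m ≤ n then C m else C n) = C n := fun m hm => by
            split_ifs with h'
            · rw [le_antisymm h' hm]
            · rfl
          rw [hm k hk, hm (k + 1) (by omega)]
          exact isHStrip_refl _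
      · dsimp only
        split_ifs with hk'
        · rw [le_antisymm hk' hk]
        · rfl
      · funext k
        beta_reduce
        split_ifs with hk
        · rfl
        · exact (h.2 k (by omega)).symm

theorem sum_paths_succ (n : ℕ) (ν : YoungDiagram) (F : (ℕ → YoungDiagram) → ℤ) :
    ∑ C ∈ paths (n + 1) ν, F C =
      ∑ κ ∈ hStrips ν, ∑ C ∈ paths n κ, F fun k => if k ≤ n then C k else ν := by
  rw [paths, Finset.sum_biUnion]
  · refine Finset.sum_congr rfl fun κ _ => Finset.sum_image fun C hC C' hC' h => funext fun k => ?_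
    rw [Finset.mem_coe, mem_paths] at hC hC'
    rcases le_or_gt k n with hk | hk
    · have := congrFun h k
      simpa [hk] using this
    · rw [hC.2 k hk.le, hC'.2 k hk.le]
  · intro κ _ κ' _ hne
    rw [Function.onFun, Finset.disjoint_left]
    rintro _ hD hD'
    obtain ⟨C, hC, rfl⟩ := Finset.mem_image.1 hD
    obtain ⟨C', hC', h⟩ := Finset.mem_image.1 hD'
    rw [mem_paths] at hC hC'
    have := congrFun h n
    simp only [le_refl, if_true] at this
    exact hne (by rw [← hC.2 n le_rfl, ← hC'.2 n le_rfl, this])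

/-- The weight of a chain: the sizes of the successive strips. -/
def wt (C : ℕ → YoungDiagram) (k : ℕ) : ℤ := (C (k + 1)).card - (C k).card

theorem hWord_apply (α : ℕ → ℤ) (n : ℕ) (f : YoungDiagram → ℤ) (ν : YoungDiagram) :
    hWord α n f ν = ∑ C ∈ paths n ν, if ∀ k < n, wt C k = α k then f (C 0) else 0 := by
  induction n generalizing ν with
  | zero => simp [hWord, paths]
  | succ n ih =>
    rw [sum_paths_succ, hWord, Module.End.mul_apply, hOp_apply, Finset.sum_filter]
    refine Finset.sum_congr rfl fun κ _ => ?_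
    have hite : ∀ (p : Prop) [Decidable p] (F : (ℕ → YoungDiagram) → ℤ),
        (if p then ∑ C ∈ paths n κ, F C else 0) = ∑ C ∈ paths n κ, if p then F C else 0 :=
      fun p _ F => by split_ifs <;> simp
    rw [ih, hite]
    refine Finset.sum_congr rfl fun C hC => ?_
    rw [mem_paths] at hC
    have hlt : ∀ k < n, wt (fun k => if k ≤ n then C k else ν) k = wt C k := fun k hk => by
      rw [wt, wt, if_pos hk.le, if_pos (by omega)]
    have hn : wt (fun k => if k ≤ n then C k else ν) n = ν.card - κ.card := by
      rw [wt, if_pos le_rfl, if_neg (by omega), hC.2 n le_rfl]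
    have hiff : (∀ k < n + 1, wt (fun k => if k ≤ n then C k else ν) k = α k) ↔
        (ν.card : ℤ) = κ.card + α n ∧ ∀ k < n, wt C k = α k := by
      constructor
      · intro h
        refine ⟨?_, fun k hk => by rw [← hlt k hk]; exact h k (by omega)⟩
        have := h n (Nat.lt_succ_self n)
        rw [hn] at this
        omega
      · rintro ⟨h1, h2⟩ k hk
        rcases Nat.lt_succ_iff_lt_or_eq.1 hk with hk | rfl
        · rw [hlt k hk]; exact h2 k hk
        · rw [hn]; omega
    simp only [hiff, Nat.zero_le, if_true, ite_and]

/-- The matrix whose determinant is the sign of the permutation carrying `α + δ` to `μ + δ`. -/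
def altMatrix (μ : YoungDiagram) (n : ℕ) (α : ℕ → ℤ) : Matrix (Fin n) (Fin n) ℤ :=
  Matrix.of fun i j => if (μ.rowLen i : ℤ) - i = α j - j then 1 else 0

/-- The sequence obtained from `μ` by the shifted action of `σ`. -/
def dotAction (μ : YoungDiagram) (n : ℕ) (σ : Equiv.Perm (Fin n)) (k : ℕ) : ℤ :=
  if h : k < n then (μ.rowLen (σ ⟨k, h⟩) : ℤ) - (σ ⟨k, h⟩ : ℕ) + k else 0

/-- The Jacobi–Trudi determinant in the operators `hOp k`. -/
def schurOp (μ : YoungDiagram) (n : ℕ) : Module.End ℤ (YoungDiagram → ℤ) :=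
  ∑ σ : Equiv.Perm (Fin n), (Equiv.Perm.sign σ : ℤ) • hWord (dotAction μ n σ) n

theorem schurOp_apply (μ : YoungDiagram) (n : ℕ) (f : YoungDiagram → ℤ) (ν : YoungDiagram) :
    schurOp μ n f ν = ∑ C ∈ paths n ν, (altMatrix μ n (wt C)).det * f (C 0) := by
  simp only [schurOp, LinearMap.sum_apply, Finset.sum_apply, LinearMap.smul_apply, Pi.smul_apply,
    hWord_apply, smul_eq_mul, Finset.mul_sum]
  rw [Finset.sum_comm]
  refine Finset.sum_congr rfl fun C _ => ?_
  rw [Matrix.det_apply', Finset.sum_mul]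
  refine Finset.sum_congr rfl fun σ _ => ?_
  have hiff : (∀ k < n, wt C k = dotAction μ n σ k) ↔
      ∀ j ∈ Finset.univ, (μ.rowLen (σ j) : ℤ) - (σ j : ℕ) = wt C (j : ℕ) - (j : ℕ) := by
    constructor
    · intro h j _
      have := h j j.2
      rw [dotAction, dif_pos j.2] at this
      rw [this]
      ring
    · intro h k hk
      have := h ⟨k, hk⟩ (Finset.mem_univ _)
      rw [dotAction, dif_pos hk]
      dsimp only at this
      linarith
  simp only [altMatrix, Matrix.of_apply, Finset.prod_ite_zero, Finset.prod_const_one, hiff]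
  split_ifs <;> simp

theorem commute_hWord {X : Module.End ℤ (YoungDiagram → ℤ)} (h : ∀ k, Commute X (hOp k))
    (α : ℕ → ℤ) (n : ℕ) : Commute X (hWord α n) := by
  induction n with
  | zero => exact Commute.one_right _
  | succ n ih => exact (h _).mul_right ih

theorem commute_schurOp {X : Module.End ℤ (YoungDiagram → ℤ)} (h : ∀ k, Commute X (hOp k))
    (μ : YoungDiagram) (n : ℕ) : Commute X (schurOp μ n) :=
  Commute.sum_right _ _ _ fun _ _ => (commute_hWord h _ _).smul_right _

theorem schurOp_commute (lam μ : YoungDiagram) (m n : ℕ) :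
    Commute (schurOp lam m) (schurOp μ n) :=
  commute_schurOp (fun k => (commute_schurOp (fun l => hOp_commute k l) _ _).symm) _ _

theorem commute_conj {X Y : Module.End ℤ (YoungDiagram → ℤ)} (h : Commute (conj * X * conj) Y) :
    Commute X (conj * Y * conj) := by
  have hc : ∀ Z, conj * (conj * Z) = Z := fun Z => by rw [← mul_assoc, conj_mul_conj, one_mul]
  have := congrArg (fun Z => conj * Z * conj) h.eq
  simp only [mul_assoc, hc] at this
  rw [conj_mul_conj, mul_one] at this
  rw [Commute, SemiconjBy]
  simp only [mul_assoc]
  exact this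

theorem schurOp_commute_conj (lam μ : YoungDiagram) (m n : ℕ) :
    Commute (schurOp lam m) (conj * schurOp μ n * conj) := by
  refine (commute_schurOp (fun k => ?_) lam m).symm
  refine (commute_conj ?_).symm
  exact commute_schurOp (fun l => (hOp_commute_eOp l k).symm) μ n

/-- The number of boxes in the first `i` rows. -/
def psum (D : YoungDiagram) (i : ℕ) : ℕ := ∑ i' ∈ Finset.range i, D.rowLen i'

theorem psum_succ (D : YoungDiagram) (i : ℕ) : psum D (i + 1) = psum D i + D.rowLen i :=
  Finset.sum_range_succ _ _

theorem psum_eq_card {D : YoungDiagram} {N : ℕ} (hN : D.rowLen N = 0) : psum D N = D.card :=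
  (card_eq_sum_rowLen hN).symm

/-- In the filling encoded by `C`, the reading word through row `i` violates the lattice condition
for the letters `k` and `k + 1`. -/
def Fails (C : ℕ → YoungDiagram) (i k : ℕ) : Prop :=
  psum (C (k + 1)) i + psum (C (k + 1)) (i + 1) < psum (C (k + 2)) (i + 1) + psum (C k) i

/-- The filling encoded by `C` has a lattice reading word. -/
def IsLattice (n : ℕ) (C : ℕ → YoungDiagram) : Prop := ∀ i k, k + 2 ≤ n → ¬ Fails C i k

/-- `(i, k)` is the first violation of the lattice condition. -/
structure IsFirst (n : ℕ) (C : ℕ → YoungDiagram) (i k : ℕ) : Prop where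
  le : k + 2 ≤ n
  fails : Fails C i k
  row : ∀ i' < i, ∀ k', k' + 2 ≤ n → ¬ Fails C i' k'
  letter : ∀ k' > k, k' + 2 ≤ n → ¬ Fails C i k'

theorem exists_isFirst {n : ℕ} {C : ℕ → YoungDiagram} (h : ¬ IsLattice n C) :
    ∃ i k, IsFirst n C i k := by
  have h' : ∃ i k, k + 2 ≤ n ∧ Fails C i k := by
    simp only [IsLattice] at h
    push Not at h
    exact h
  obtain ⟨k, hk⟩ := Nat.find_spec h'
  have hs := Nat.findGreatest_spec (P := fun k => k + 2 ≤ n ∧ Fails C (Nat.find h') k)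
    (n := n) (by omega) hk
  refine ⟨Nat.find h', _, hs.1, hs.2, fun i' hi' k' hk' hf => Nat.find_min h' hi' ⟨k', hk', hf⟩,
    fun k' hk' hn hf => ?_⟩
  exact Nat.findGreatest_is_greatest hk' (by omega) ⟨hn, hf⟩

theorem IsFirst.unique {n : ℕ} {C : ℕ → YoungDiagram} {i k i' k' : ℕ} (h : IsFirst n C i k)
    (h' : IsFirst n C i' k') : i = i' ∧ k = k' := by
  have hi : i = i' := by
    rcases lt_trichotomy i i' with hi | hi | hi
    · exact (h'.row i hi k h.le h.fails).elim
    · exact hi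
    · exact (h.row i' hi k' h'.le h'.fails).elim
  subst hi
  refine ⟨rfl, ?_⟩
  rcases lt_trichotomy k k' with hk | hk | hk
  · exact (h.letter k' hk h'.le h'.fails).elim
  · exact hk
  · exact (h'.letter k hk h.le h.fails).elim

/-- The largest possible length of row `i` of `C (k + 1)` for which `Fails C i k`. -/
def pivot (C : ℕ → YoungDiagram) (i k : ℕ) : ℕ :=
  psum (C (k + 2)) (i + 1) + psum (C k) i - psum (C (k + 1)) i - psum (C (k + 1)) i - 1

/-- The reflection of the letters `k` and `k + 1` after the violation at row `i`. -/
def reflectAt (C : ℕ → YoungDiagram) (i k : ℕ) : ℕ → YoungDiagram :=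
  Function.update C (k + 1) (toggle (C k) (C (k + 1)) (C (k + 2)) i (pivot C i k))

theorem reflectAt_self (C : ℕ → YoungDiagram) (i k : ℕ) : reflectAt C i k (k + 1) =
    toggle (C k) (C (k + 1)) (C (k + 2)) i (pivot C i k) := by
  rw [reflectAt, Function.update_self]

theorem reflectAt_of_ne (C : ℕ → YoungDiagram) (i k : ℕ) {l : ℕ} (h : l ≠ k + 1) :
    reflectAt C i k l = C l := by
  rw [reflectAt, Function.update_of_ne h]

namespace IsFirst

variable {n : ℕ} {ν : YoungDiagram} {C : ℕ → YoungDiagram} {i k : ℕ}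

theorem togglable (h : IsFirst n C i k) (hC : IsPath n ν C) :
    Togglable (C k) (C (k + 1)) (C (k + 2)) i (pivot C i k) := by
  have hf := h.fails
  rw [Fails, psum_succ (C (k + 1)), psum_succ (C (k + 2))] at hf
  have ha : pivot C i k ≤ (C (k + 2)).rowLen i ∧
      ∀ i', i' + 1 = i → pivot C i k ≤ (C k).rowLen i' := by
    rw [pivot, psum_succ (C (k + 2))]
    cases i with
    | zero => simp [psum]
    | succ m =>
      have hr := h.row m (Nat.lt_succ_self m) k h.le
      rw [Fails, psum_succ (C (k + 1)), psum_succ (C (k + 2))] at hr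
      have h1 := hC.1 k m
      have h2 := hC.1 (k + 1) m
      rw [show k + 1 + 1 = k + 2 from rfl] at h2
      rw [psum_succ (C (k + 1)), psum_succ (C (k + 2)), psum_succ (C k)]
      refine ⟨by omega, ?_⟩
      rintro i' hi'
      obtain rfl : i' = m := by omega
      omega
  refine ⟨hC.1 k, hC.1 (k + 1), ?_, ha.1, ha.2⟩
  rw [pivot, psum_succ (C (k + 2))]
  omega

theorem psum_reflectAt (h : IsFirst n C i k) (hC : IsPath n ν C) (l : ℕ) {m : ℕ} (hm : m ≤ i) :
    psum (reflectAt C i k l) m = psum (C l) m := by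
  by_cases hl : l = k + 1
  · subst hl
    rw [reflectAt_self]
    exact Finset.sum_congr rfl fun i' hi' =>
      (h.togglable hC).rowLen_toggle_of_lt ((Finset.mem_range.1 hi').trans_le hm)
  · rw [reflectAt_of_ne _ _ _ hl]

theorem pivot_reflectAt (h : IsFirst n C i k) (hC : IsPath n ν C) :
    pivot (reflectAt C i k) i k = pivot C i k := by
  rw [pivot, reflectAt_of_ne C i k (show k + 2 ≠ k + 1 by omega),
    h.psum_reflectAt hC _ le_rfl, h.psum_reflectAt hC _ le_rfl]
  rfl

theorem reflectAt_reflectAt (h : IsFirst n C i k) (hC : IsPath n ν C) :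
    ChernTensor.reflectAt (ChernTensor.reflectAt C i k) i k = C := by
  rw [ChernTensor.reflectAt, h.pivot_reflectAt hC, reflectAt_self,
    reflectAt_of_ne C i k (show k + 2 ≠ k + 1 by omega), reflectAt_of_ne C i k (show k ≠ k + 1 by omega),
    (h.togglable hC).toggle_toggle, ChernTensor.reflectAt, Function.update_idem,
    Function.update_eq_self]

theorem isPath_reflectAt (h : IsFirst n C i k) (hC : IsPath n ν C) :
    IsPath n ν (reflectAt C i k) := by
  have ht := (h.togglable hC).toggle
  refine ⟨fun l => ?_, fun l hl => ?_⟩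
  · rcases eq_or_ne l k with rfl | hlk
    · rw [reflectAt_self, reflectAt_of_ne _ _ _ (by omega)]
      exact ht.left
    rcases eq_or_ne l (k + 1) with rfl | hlk'
    · rw [reflectAt_self, reflectAt_of_ne _ _ _ (by omega)]
      exact ht.right
    · rw [reflectAt_of_ne _ _ _ hlk', reflectAt_of_ne _ _ _ (by omega)]
      exact hC.1 l
  · have := h.le
    rw [reflectAt_of_ne _ _ _ (by omega)]
    exact hC.2 l hl

theorem reflectAt (h : IsFirst n C i k) (hC : IsPath n ν C) :
    IsFirst n (reflectAt C i k) i k where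
  le := h.le
  fails := by
    have hf := h.fails
    have hj := (h.togglable hC).rowLen_toggle_le
    rw [Fails, psum_succ (C (k + 1))] at hf
    rw [Fails, reflectAt_of_ne C i k (show k + 2 ≠ k + 1 by omega), psum_succ,
      h.psum_reflectAt hC _ le_rfl, h.psum_reflectAt hC _ le_rfl, reflectAt_self]
    rw [pivot] at hj
    unfold pivot
    omega
  row i' hi' k' hk' := by
    have := h.row i' hi' k' hk'
    rwa [Fails, h.psum_reflectAt hC _ hi'.le, h.psum_reflectAt hC _ hi'.le,
      h.psum_reflectAt hC _ hi', h.psum_reflectAt hC _ hi']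
  letter k' hk' hn := by
    have := h.letter k' hk' hn
    rwa [Fails, reflectAt_of_ne C i k (show k' + 1 ≠ k + 1 by omega),
      reflectAt_of_ne C i k (show k' + 2 ≠ k + 1 by omega), h.psum_reflectAt hC _ le_rfl]

theorem wt_reflectAt (h : IsFirst n C i k) (hC : IsPath n ν C) :
    wt (ChernTensor.reflectAt C i k) k = wt C (k + 1) - 1 ∧
      wt (ChernTensor.reflectAt C i k) (k + 1) = wt C k + 1 ∧
      ∀ l, l ≠ k → l ≠ k + 1 → wt (ChernTensor.reflectAt C i k) l = wt C l := by
  have hf := h.fails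
  have hc := (h.togglable hC).card_toggle
  rw [Fails, psum_succ (C (k + 1))] at hf
  change _ + _ + psum (C (k + 2)) (i + 1) + psum (C k) i = 2 * psum (C (k + 1)) i + _ + _ + _ at hc
  have hp : pivot C i k + 1 + 2 * psum (C (k + 1)) i = psum (C (k + 2)) (i + 1) + psum (C k) i := by
    rw [pivot]
    omega
  refine ⟨?_, ?_, fun l hl hl' => ?_⟩
  · rw [wt, wt, reflectAt_self, reflectAt_of_ne _ _ _ (by omega)]
    change _ = ((C (k + 2)).card : ℤ) - _ - 1
    omega
  · rw [wt, wt, reflectAt_self, reflectAt_of_ne _ _ _ (by omega)]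
    change ((C (k + 2)).card : ℤ) - _ = _
    omega
  · rw [wt, wt, reflectAt_of_ne _ _ _ hl', reflectAt_of_ne _ _ _ (by omega)]

theorem det_reflectAt (h : IsFirst n C i k) (hC : IsPath n ν C) (μ : YoungDiagram) :
    (altMatrix μ n (wt (ChernTensor.reflectAt C i k))).det = -(altMatrix μ n (wt C)).det := by
  have hn := h.le
  obtain ⟨h1, h2, h3⟩ := h.wt_reflectAt hC
  set x : Fin n := ⟨k, by omega⟩ with hx
  set y : Fin n := ⟨k + 1, by omega⟩ with hy
  have hxy : x ≠ y := by simp [hx, hy]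
  have hm : altMatrix μ n (wt (ChernTensor.reflectAt C i k)) =
      (altMatrix μ n (wt C)).submatrix id (Equiv.swap x y) := by
    ext p q
    rw [Matrix.submatrix_apply, altMatrix, altMatrix, Matrix.of_apply, Matrix.of_apply]
    congr 2
    rcases eq_or_ne q x with rfl | hqx
    · rw [Equiv.swap_apply_left]
      simp only [hx, hy, h1]
      push_cast
      ring
    rcases eq_or_ne q y with rfl | hqy
    · rw [Equiv.swap_apply_right]
      simp only [hx, hy, h2]
      push_cast
      ring
    · rw [Equiv.swap_apply_of_ne_of_ne hqx hqy,
        h3 q (fun h => hqx (Fin.ext h)) (fun h => hqy (Fin.ext h))]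
  rw [hm, Matrix.det_permute', Equiv.Perm.sign_swap hxy]
  simp

end IsFirst

/-- The sign-reversing involution on chains without lattice reading word. -/
def reflect (n : ℕ) (C : ℕ → YoungDiagram) : ℕ → YoungDiagram :=
  if h : ¬ IsLattice n C then
    reflectAt C (exists_isFirst h).choose (exists_isFirst h).choose_spec.choose
  else C

theorem IsFirst.reflect_eq {n : ℕ} {C : ℕ → YoungDiagram} {i k : ℕ} (h : IsFirst n C i k) :
    reflect n C = ChernTensor.reflectAt C i k := by
  have hL : ¬ IsLattice n C := fun hL => hL i k h.le h.fails
  obtain ⟨h1, h2⟩ := (exists_isFirst hL).choose_spec.choose_spec.unique h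
  rw [reflect, dif_pos hL, h2, h1]

theorem sum_not_isLattice (μ ν : YoungDiagram) (n : ℕ) (f : YoungDiagram → ℤ) :
    ∑ C ∈ (paths n ν).filter fun C => ¬ IsLattice n C,
      (altMatrix μ n (wt C)).det * f (C 0) = 0 := by
  refine Finset.sum_involution (fun C _ => reflect n C) ?_ ?_ ?_ ?_
  · intro C hC
    rw [Finset.mem_filter, mem_paths] at hC
    obtain ⟨i, k, h⟩ := exists_isFirst hC.2
    rw [h.reflect_eq, h.det_reflectAt hC.1, reflectAt_of_ne _ _ _ (by omega)]
    ring
  · intro C hC hne heq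
    rw [Finset.mem_filter, mem_paths] at hC
    obtain ⟨i, k, h⟩ := exists_isFirst hC.2
    have hd := h.det_reflectAt hC.1 μ
    rw [← h.reflect_eq, heq] at hd
    have : (altMatrix μ n (wt C)).det = 0 := by linarith
    rw [this, zero_mul] at hne
    exact hne rfl
  · intro C hC
    rw [Finset.mem_filter, mem_paths] at hC ⊢
    obtain ⟨i, k, h⟩ := exists_isFirst hC.2
    rw [h.reflect_eq]
    have h' := h.reflectAt hC.1
    exact ⟨h.isPath_reflectAt hC.1, fun hL => hL i k h'.le h'.fails⟩
  · intro C hC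
    rw [Finset.mem_filter, mem_paths] at hC
    obtain ⟨i, k, h⟩ := exists_isFirst hC.2
    rw [h.reflect_eq, (h.reflectAt hC.1).reflect_eq, h.reflectAt_reflectAt hC.1]

theorem IsLattice.wt_anti {n : ℕ} {C : ℕ → YoungDiagram} (h : IsLattice n C) {k : ℕ}
    (hk : k + 2 ≤ n) : wt C (k + 1) ≤ wt C k := by
  set N := (C k).colLen 0 + (C (k + 1)).colLen 0 + (C (k + 2)).colLen 0 with hN
  have hz : ∀ D : YoungDiagram, ∀ m, D.colLen 0 ≤ m → psum D m = D.card := fun D m hm =>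
    psum_eq_card (rowLen_eq_zero_of_le (rowLen_colLen_zero D) hm)
  have := h N k hk
  rw [Fails, hz (C k) _ (by omega), hz (C (k + 1)) _ (by omega), hz (C (k + 1)) _ (by omega),
    hz (C (k + 2)) _ (by omega)] at this
  rw [wt, wt, show k + 1 + 1 = k + 2 from rfl]
  omega

theorem det_strictAnti {n : ℕ} {a b : Fin n → ℤ} (ha : StrictAnti a) (hb : StrictAnti b) :
    (Matrix.of fun i j => if a i = b j then (1 : ℤ) else 0).det = if a = b then 1 else 0 := by
  split_ifs with hab
  · subst hab
    rw [show (Matrix.of fun i j => if a i = a j then (1 : ℤ) else 0) = 1 by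
      ext i j
      simp [Matrix.one_apply, ha.injective.eq_iff]]
    exact Matrix.det_one
  · rw [Matrix.det_apply']
    refine Finset.sum_eq_zero fun σ _ => ?_
    simp only [Matrix.of_apply, Finset.prod_ite_zero, Finset.prod_const_one]
    rw [if_neg, mul_zero]
    intro h
    refine hab ?_
    have hr : Set.range (fun i => - a i) = Set.range (fun i => - b i) := by
      have : (fun i => - b i) = (fun i => - a i) ∘ σ :=
        funext fun j => by simp [h j (Finset.mem_univ _)]
      rw [this, σ.surjective.range_comp]
    have := (StrictMono.range_inj (f := fun i => - a i) (g := fun i => - b i)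
      (fun x y h => neg_lt_neg (ha h)) (fun x y h => neg_lt_neg (hb h))).1 hr
    exact funext fun i => neg_injective (congrFun this i)

theorem IsLattice.det_altMatrix {n : ℕ} {C : ℕ → YoungDiagram} (h : IsLattice n C)
    (μ : YoungDiagram) : (altMatrix μ n (wt C)).det =
      if ∀ k < n, wt C k = μ.rowLen k then 1 else 0 := by
  have key : ∀ β : ℕ → ℤ, (∀ k, k + 2 ≤ n → β (k + 1) ≤ β k) →
      StrictAnti fun i : Fin n => β i - (i : ℕ) := by
    intro β hβ
    have hle : ∀ k l, k ≤ l → l < n → β l ≤ β k := fun k l hkl => by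
      induction l, hkl using Nat.le_induction with
      | base => exact fun _ => le_rfl
      | succ m _ ih => exact fun hm => (hβ m (by omega)).trans (ih (by omega))
    intro i j hij
    have := hle i j (le_of_lt hij) j.2
    have hij' : (i : ℕ) < j := hij
    dsimp only
    omega
  have := det_strictAnti (key (fun k => μ.rowLen k) fun k _ => by
    exact_mod_cast μ.rowLen_anti _ _ (Nat.le_succ k)) (key (wt C) fun k hk => h.wt_anti hk)
  rw [altMatrix, this]
  refine if_congr ⟨fun h k hk => ?_, fun h => funext fun i => ?_⟩ rfl rfl
  · have := congrFun h ⟨k, hk⟩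
    dsimp only at this
    linarith
  · rw [h i i.2]

/-- The lattice chains of weight `μ` ending at `ν`. -/
def latticePaths (μ : YoungDiagram) (n : ℕ) (ν : YoungDiagram) : Finset (ℕ → YoungDiagram) :=
  (paths n ν).filter fun C => IsLattice n C ∧ ∀ k < n, wt C k = μ.rowLen k

theorem mem_latticePaths {μ ν : YoungDiagram} {n : ℕ} {C : ℕ → YoungDiagram} :
    C ∈ latticePaths μ n ν ↔
      IsPath n ν C ∧ IsLattice n C ∧ ∀ k < n, wt C k = μ.rowLen k := by
  rw [latticePaths, Finset.mem_filter, mem_paths]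

/-- The Littlewood–Richardson rule for the operators `schurOp`. -/
theorem schurOp_apply_eq_sum_latticePaths (μ : YoungDiagram) (n : ℕ) (f : YoungDiagram → ℤ)
    (ν : YoungDiagram) : schurOp μ n f ν = ∑ C ∈ latticePaths μ n ν, f (C 0) := by
  rw [schurOp_apply, ← Finset.sum_filter_add_sum_filter_not _ (IsLattice n),
    sum_not_isLattice, add_zero, latticePaths, ← Finset.filter_filter,
    Finset.sum_filter (fun C => ∀ k < n, wt C k = μ.rowLen k)]
  refine Finset.sum_congr rfl fun C hC => ?_
  rw [(Finset.mem_filter.1 hC).2.det_altMatrix]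
  split_ifs <;> simp

/-- The indicator function of a diagram. -/
def single (lam ν : YoungDiagram) : ℤ := if ν = lam then 1 else 0

/-- The diagram formed by the first `k` rows of `μ`. -/
def firstRows (μ : YoungDiagram) (k : ℕ) : YoungDiagram :=
  trim μ (fun i => if i < k then μ.rowLen i else 0) fun i i' h => by
    have := μ.rowLen_anti i i' h
    dsimp only
    split_ifs <;> omega

theorem rowLen_firstRows (μ : YoungDiagram) (k i : ℕ) :
    (firstRows μ k).rowLen i = if i < k then μ.rowLen i else 0 :=
  rowLen_trim (by split_ifs <;> simp)

theorem psum_firstRows (μ : YoungDiagram) (k i : ℕ) :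
    psum (firstRows μ k) i = psum μ (min i k) := by
  induction i with
  | zero => simp [psum]
  | succ i ih =>
    rw [psum_succ, ih, rowLen_firstRows]
    split_ifs with h
    · rw [min_eq_left h.le, min_eq_left (Nat.succ_le_of_lt h), psum_succ]
    · rw [min_eq_right (by omega), min_eq_right (by omega), add_zero]

theorem card_firstRows (μ : YoungDiagram) (k : ℕ) : (firstRows μ k).card = psum μ k := by
  rw [← psum_eq_card (N := k) (by simp [rowLen_firstRows]), psum_firstRows, min_self]

theorem firstRows_of_le {μ : YoungDiagram} {n k : ℕ} (hn : μ.rowLen n = 0) (h : n ≤ k) :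
    firstRows μ k = μ := by
  refine ext_rowLen fun i => ?_
  rw [rowLen_firstRows]
  split_ifs with hi
  · rfl
  · exact (rowLen_eq_zero_of_le hn (by omega)).symm

theorem firstRows_zero (μ : YoungDiagram) : firstRows μ 0 = ⊥ :=
  ext_rowLen fun i => by simp [rowLen_firstRows, rowLen_bot]

theorem firstRows_mem_latticePaths {μ : YoungDiagram} {n : ℕ} (hn : μ.rowLen n = 0) :
    firstRows μ ∈ latticePaths μ n μ := by
  rw [mem_latticePaths]
  refine ⟨⟨fun k i => ?_, fun k hk => firstRows_of_le hn hk⟩, fun i k _ => ?_, fun k _ => ?_⟩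
  · simp only [rowLen_firstRows]
    have := μ.rowLen_anti i (i + 1) (Nat.le_succ i)
    split_ifs <;> omega
  · rw [Fails]
    simp only [psum_firstRows]
    rcases lt_or_ge i (k + 1) with h | h
    · rw [min_eq_left (show i + 1 ≤ k + 2 by omega), min_eq_left (show i ≤ k + 1 by omega),
        min_eq_left (show i + 1 ≤ k + 1 by omega), min_eq_left (show i ≤ k by omega)]
      omega
    · rw [min_eq_right (show k + 1 ≤ i by omega), min_eq_right (show k + 1 ≤ i + 1 by omega),
        min_eq_right (show k + 2 ≤ i + 1 by omega), min_eq_right (show k ≤ i by omega),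
        psum_succ μ (k + 1), psum_succ μ k]
      have := μ.rowLen_anti k (k + 1) (Nat.le_succ k)
      omega
  · rw [wt, card_firstRows, card_firstRows, psum_succ]
    push_cast
    ring

theorem IsPath.psum_le {n : ℕ} {ν : YoungDiagram} {C : ℕ → YoungDiagram} (h : IsPath n ν C)
    (k i : ℕ) : psum (C k) i ≤ psum (C (k + 1)) i :=
  Finset.sum_le_sum fun i' _ => (h.1 k i').1

/-- The only lattice chain starting at the empty diagram is the canonical one. -/
theorem eq_firstRows {μ ν : YoungDiagram} {n : ℕ} (hn : μ.rowLen n = 0) {C : ℕ → YoungDiagram}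
    (hC : C ∈ latticePaths μ n ν) (h0 : C 0 = ⊥) : C = firstRows μ := by
  obtain ⟨hp, hL, hw⟩ := mem_latticePaths.1 hC
  have hz : ∀ k i, k ≤ i → (C k).rowLen i = 0 := by
    intro k
    induction k with
    | zero => intro i _; rw [h0, rowLen_bot]
    | succ k ih =>
      intro i hi
      obtain ⟨i', rfl⟩ : ∃ i', i = i' + 1 := ⟨i - 1, by omega⟩
      have := (hp.1 k i').2
      rw [ih i' (by omega)] at this
      omega
  have hcard : ∀ k, k ≤ n → (C k).card = psum μ k := by
    intro k
    induction k with
    | zero => intro _; rw [h0]; simp [psum]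
    | succ k ih =>
      intro hk
      have h1 := hw k (by omega)
      have h2 := ih (by omega)
      rw [wt] at h1
      rw [psum_succ]
      omega
  have hstep : ∀ i k, i ≤ k → k < n → psum (C (k + 1)) i = psum (C k) i := by
    intro i
    induction i with
    | zero => intro k _ _; simp [psum]
    | succ i ih =>
      intro k hik hk
      obtain ⟨k', rfl⟩ : ∃ k', k = k' + 1 := ⟨k - 1, by omega⟩
      have h1 := hL i k' (by omega)
      have h2 := ih k' (by omega) (by omega)
      have h3 := hp.psum_le (k' + 1) (i + 1)
      rw [Fails] at h1
      rw [show k' + 1 + 1 = k' + 2 from rfl] at h3 ⊢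
      omega
  have hpsum : ∀ i k, i ≤ k → k ≤ n → psum (C k) i = psum μ i := by
    intro i k hik
    induction k, hik using Nat.le_induction with
    | base => intro hi; rw [psum_eq_card (hz i i le_rfl), hcard i hi]
    | succ k hik ih => intro hk; rw [hstep i k hik (by omega), ih (by omega)]
  have hle : ∀ k ≤ n, C k = firstRows μ k := fun k hk => ext_rowLen fun i => by
    rw [rowLen_firstRows]
    split_ifs with hi
    · have h1 := hpsum i k hi.le hk
      have h2 := hpsum (i + 1) k hi hk
      rw [psum_succ, psum_succ] at h2
      omega
    · exact hz k i (by omega)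
  funext k
  rcases le_or_gt k n with hk | hk
  · exact hle k hk
  · rw [hp.2 k hk.le, ← hp.2 n le_rfl, hle n le_rfl, firstRows_of_le hn le_rfl,
      firstRows_of_le hn hk.le]

theorem schurOp_single_bot {μ : YoungDiagram} {n : ℕ} (hn : μ.rowLen n = 0) :
    schurOp μ n (single ⊥) = single μ := by
  funext ν
  rw [schurOp_apply_eq_sum_latticePaths]
  by_cases hν : ν = μ
  · subst hν
    rw [Finset.sum_eq_single_of_mem _ (firstRows_mem_latticePaths hn), firstRows_zero, single,
      single, if_pos rfl, if_pos rfl]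
    intro C hC hne
    exact if_neg fun h0 => hne (eq_firstRows hn hC h0)
  · rw [single, if_neg hν]
    refine Finset.sum_eq_zero fun C hC => if_neg fun h0 => hν ?_
    rw [← (mem_latticePaths.1 hC).1.2 n le_rfl, eq_firstRows hn hC h0, firstRows_of_le hn le_rfl]

/-- `C` is the chain of sublevel diagrams of the filling `T` of `ν`. -/
structure Encodes (ν : YoungDiagram) (T : ℕ × ℕ → ℕ) (C : ℕ → YoungDiagram) : Prop where
  mem_iff : ∀ k c, c ∈ C k ↔ c ∈ ν ∧ T c ≤ k
  eq_zero : ∀ c, c ∉ ν → T c = 0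

namespace Encodes

variable {ν lam μ : YoungDiagram} {T : ℕ × ℕ → ℕ} {C : ℕ → YoungDiagram} {n : ℕ}

theorem le_succ (h : Encodes ν T C) (k : ℕ) : C k ≤ C (k + 1) := fun c hc => by
  change c ∈ C k at hc
  rw [h.mem_iff] at hc ⊢
  exact ⟨hc.1, hc.2.trans (Nat.le_succ k)⟩

theorem mem_sdiff_iff (h : Encodes ν T C) (h0 : C 0 = lam) (c : ℕ × ℕ) :
    c ∈ ν.cells \ lam.cells ↔ T c ≠ 0 := by
  have := h.eq_zero c
  rw [← h0, Finset.mem_sdiff, YoungDiagram.mem_cells, YoungDiagram.mem_cells, h.mem_iff]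
  constructor
  · exact fun hc hT => hc.2 ⟨hc.1, hT.le⟩
  · exact fun hT => ⟨by_contra fun hc => hT (this hc), fun hc => hT (Nat.le_zero.1 hc.2)⟩

theorem eq_succ_iff (h : Encodes ν T C) (i j k : ℕ) :
    T (i, j) = k + 1 ↔ (C k).rowLen i ≤ j ∧ j < (C (k + 1)).rowLen i := by
  have := h.eq_zero (i, j)
  rw [← not_lt, ← YoungDiagram.mem_iff_lt_rowLen, ← YoungDiagram.mem_iff_lt_rowLen, h.mem_iff,
    h.mem_iff]
  by_cases hc : (i, j) ∈ ν
  · simp only [hc, true_and]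
    omega
  · simp only [hc, false_and, and_false, iff_false]
    rw [this hc]
    omega

theorem card_filter_word (h : Encodes ν T C) (h0 : C 0 = lam) (i j k : ℕ) :
    ((ν.cells \ lam.cells).filter
      (fun d => (d.1 < i ∨ (d.1 = i ∧ j ≤ d.2)) ∧ T d = k + 1)).card + psum (C k) i =
    psum (C (k + 1)) i + ((C (k + 1)).rowLen i - max ((C k).rowLen i) j) := by
  have hfib := Finset.card_eq_sum_card_fiberwise (f := Prod.fst) (t := Finset.range (i + 1))
    (s := (ν.cells \ lam.cells).filter
      (fun d => (d.1 < i ∨ (d.1 = i ∧ j ≤ d.2)) ∧ T d = k + 1)) (fun d hd => by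
      simp only [Finset.coe_filter, Set.mem_ofPred_eq] at hd
      simp only [Finset.coe_range, Set.mem_Iio]
      omega)
  have hcard : ∀ i' ∈ Finset.range (i + 1), (((ν.cells \ lam.cells).filter
      (fun d => (d.1 < i ∨ (d.1 = i ∧ j ≤ d.2)) ∧ T d = k + 1)).filter (·.1 = i')).card =
      (C (k + 1)).rowLen i' - max ((C k).rowLen i') (if i' < i then 0 else j) := by
    intro i' hi'
    rw [Finset.mem_range] at hi'
    rw [← Nat.card_Ico, ← Finset.card_image_of_injective (Finset.Ico _ _) (Prod.mk_right_injective i')]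
    refine congrArg Finset.card ?_
    ext ⟨a, b⟩
    simp only [Finset.mem_filter, Finset.mem_image, Finset.mem_Ico, Prod.mk.injEq, max_le_iff,
      h.mem_sdiff_iff h0, h.eq_succ_iff]
    constructor
    · rintro ⟨⟨_, h1, h2⟩, rfl⟩
      refine ⟨b, ⟨⟨h2.1, ?_⟩, h2.2⟩, rfl, rfl⟩
      split_ifs <;> omega
    · rintro ⟨b, ⟨⟨h1, h2⟩, h3⟩, rfl, rfl⟩
      refine ⟨⟨?_, ?_, h1, h3⟩, rfl⟩
      · rw [(h.eq_succ_iff i' b k).2 ⟨h1, h3⟩]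
        omega
      · split_ifs at h2 <;> omega
  rw [hfib, Finset.sum_congr rfl hcard, Finset.sum_range_succ, if_neg (lt_irrefl i)]
  have hs : ∑ i' ∈ Finset.range i, ((C (k + 1)).rowLen i' -
      max ((C k).rowLen i') (if i' < i then 0 else j)) + psum (C k) i = psum (C (k + 1)) i := by
    rw [psum, psum, ← Finset.sum_add_distrib]
    refine Finset.sum_congr rfl fun i' hi' => ?_
    rw [if_pos (Finset.mem_range.1 hi'), max_eq_left (Nat.zero_le _)]
    have := le_iff_rowLen_le.1 (h.le_succ k) i'
    omega
  omega

theorem card_filter (h : Encodes ν T C) (h0 : C 0 = lam) (k : ℕ) :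
    (((ν.cells \ lam.cells).filter (fun c => T c = k + 1)).card : ℤ) = wt C k := by
  have : (ν.cells \ lam.cells).filter (fun c => T c = k + 1) = (C (k + 1)).cells \ (C k).cells := by
    ext c
    have := h.eq_zero c
    rw [Finset.mem_filter, h.mem_sdiff_iff h0, Finset.mem_sdiff, YoungDiagram.mem_cells,
      YoungDiagram.mem_cells, h.mem_iff, h.mem_iff]
    by_cases hc : c ∈ ν
    · simp only [hc, true_and]
      omega
    · simp only [hc, false_and, iff_false]
      rw [this hc]
      omega
  have hsub := YoungDiagram.cells_subset_iff.2 (h.le_succ k)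
  rw [this, Finset.card_sdiff_of_subset hsub, wt, Nat.cast_sub (Finset.card_le_card hsub)]

theorem monotone (h : Encodes ν T C) {c d : ℕ × ℕ} (hcd : c ≤ d) (hd : d ∈ ν) : T c ≤ T d := by
  have : c ∈ C (T d) := (C (T d)).isLowerSet hcd ((h.mem_iff _ _).2 ⟨hd, le_rfl⟩)
  exact ((h.mem_iff _ _).1 this).2

theorem word_iff (h : Encodes ν T C) (h0 : C 0 = lam) (hp : IsPath n ν C) :
    (∀ c ∈ ν.cells \ lam.cells, ∀ k : ℕ,
    (((ν.cells \ lam.cells).filter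
        (fun d => (d.1 < c.1 ∨ (d.1 = c.1 ∧ c.2 ≤ d.2)) ∧ T d = k + 2)).card ≤
     ((ν.cells \ lam.cells).filter
        (fun d => (d.1 < c.1 ∨ (d.1 = c.1 ∧ c.2 ≤ d.2)) ∧ T d = k + 1)).card)) ↔
      IsLattice n C := by
  constructor
  · intro hw i k hk
    induction i using Nat.strong_induction_on with | _ i ih =>
    have h4 := le_iff_rowLen_le.1 (h.le_succ (k + 1)) i
    rcases h4.lt_or_eq with hlt | heq
    · have hm : (i, (C (k + 1)).rowLen i) ∈ ν.cells \ lam.cells := by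
        rw [h.mem_sdiff_iff h0, (h.eq_succ_iff i _ (k + 1)).2 ⟨le_rfl, hlt⟩]
        omega
      have := hw _ hm k
      dsimp only at this
      have h1 := h.card_filter_word h0 i ((C (k + 1)).rowLen i) k
      have h2 := h.card_filter_word h0 i ((C (k + 1)).rowLen i) (k + 1)
      rw [show k + 1 + 1 = k + 2 from rfl] at h2 hlt
      rw [Fails, psum_succ, psum_succ]
      have := le_iff_rowLen_le.1 (h.le_succ k) i
      rw [max_self] at h2
      rw [max_eq_right this] at h1
      omega
    · rw [show k + 1 + 1 = k + 2 from rfl] at heq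
      rw [Fails, psum_succ, psum_succ, ← heq]
      cases i with
      | zero => simp [psum]
      | succ i =>
        have := ih i (Nat.lt_succ_self i)
        have h3 := le_iff_rowLen_le.1 (h.le_succ k) i
        rw [Fails] at this
        rw [psum_succ (C k)]
        rw [psum_succ (C (k + 1))] at this ⊢
        omega
  · rintro hL ⟨i, j⟩ - k
    dsimp only
    have h1 := h.card_filter_word h0 i j k
    have h2 := h.card_filter_word h0 i j (k + 1)
    have h3 := le_iff_rowLen_le.1 (h.le_succ k) i
    have h4 := le_iff_rowLen_le.1 (h.le_succ (k + 1)) i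
    have h5 := hp.psum_le k i
    rw [show k + 1 + 1 = k + 2 from rfl] at h2 h4
    rcases le_or_gt (k + 2) n with hk | hk
    · have := hL i k hk
      rw [Fails, psum_succ, psum_succ] at this
      omega
    · rw [hp.2 (k + 2) (by omega), hp.2 (k + 1) (by omega)] at h2
      omega

end Encodes

namespace Encodes

variable {ν lam μ : YoungDiagram} {T : ℕ × ℕ → ℕ} {C : ℕ → YoungDiagram} {n : ℕ}

theorem isPath (h : Encodes ν T C) (h0 : C 0 = lam)
    (hcol : ∀ i i' j, i < i' → (i, j) ∈ ν.cells \ lam.cells → (i', j) ∈ ν.cells \ lam.cells →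
      T (i, j) < T (i', j)) (hn : ∀ c ∈ ν, T c ≤ n) : IsPath n ν C := by
  refine ⟨fun k i => ⟨le_iff_rowLen_le.1 (h.le_succ k) i, ?_⟩, fun k hk => ?_⟩
  · refine le_of_forall_lt fun j hj => ?_
    rw [← YoungDiagram.mem_iff_lt_rowLen, h.mem_iff] at hj ⊢
    refine ⟨ν.up_left_mem (Nat.le_succ i) le_rfl hj.1, ?_⟩
    by_contra! hlt
    have hm : (i, j) ∈ ν.cells \ lam.cells := (h.mem_sdiff_iff h0 _).2 (by omega)
    have hle := h.monotone (c := (i, j)) (d := (i + 1, j)) ⟨Nat.le_succ i, le_rfl⟩ hj.1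
    have hm' : (i + 1, j) ∈ ν.cells \ lam.cells := (h.mem_sdiff_iff h0 _).2 (by omega)
    have := hcol i (i + 1) j (Nat.lt_succ_self i) hm hm'
    omega
  · refine YoungDiagram.ext (Finset.ext fun c => ?_)
    rw [YoungDiagram.mem_cells, YoungDiagram.mem_cells, h.mem_iff, and_iff_left_iff_imp]
    exact fun hc => (hn c hc).trans hk

theorem lt_of_isPath (h : Encodes ν T C) (h0 : C 0 = lam) (hp : IsPath n ν C) {i i' j : ℕ}
    (hi : i < i') (hm' : (i', j) ∈ ν.cells \ lam.cells) : T (i, j) < T (i', j) := by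
  have hT := (h.mem_sdiff_iff h0 _).1 hm'
  obtain ⟨m, hm⟩ := Nat.exists_eq_succ_of_ne_zero hT
  rw [hm, Nat.lt_succ_iff]
  have hν : (i', j) ∈ ν := (Finset.mem_sdiff.1 hm').1
  have h1 : (i + 1, j) ∈ C (m + 1) :=
    (C (m + 1)).up_left_mem hi le_rfl ((h.mem_iff _ _).2 ⟨hν, hm.le⟩)
  have h2 : (i, j) ∈ C m := YoungDiagram.mem_iff_lt_rowLen.2
    ((YoungDiagram.mem_iff_lt_rowLen.1 h1).trans_le (hp.1 m i).2)
  exact ((h.mem_iff _ _).1 h2).2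

theorem isLRTableau_iff (h : Encodes ν T C) (hn : μ.rowLen n = 0) :
    (IsLRTableau lam μ ν T ∧ C 0 = lam) ↔ (C ∈ latticePaths μ n ν ∧ C 0 = lam) := by
  refine and_congr_left fun h0 => ?_
  rw [mem_latticePaths]
  have hwt : ∀ k, wt C k = μ.rowLen k ↔
      ((ν.cells \ lam.cells).filter (fun c => T c = k + 1)).card = μ.rowLen k := fun k => by
    rw [← h.card_filter h0 k, Nat.cast_inj]
  constructor
  · rintro ⟨-, -, hcol, hcard, hword⟩
    have hp : IsPath n ν C := by
      refine h.isPath h0 hcol fun c hc => ?_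
      by_contra! hlt
      obtain ⟨k, hk⟩ : ∃ k, T c = k + 1 := ⟨T c - 1, by omega⟩
      have h1 := hcard k
      rw [rowLen_eq_zero_of_le hn (by omega), Finset.card_eq_zero] at h1
      refine Finset.notMem_empty c (h1 ▸ Finset.mem_filter.2 ⟨?_, hk⟩)
      rw [h.mem_sdiff_iff h0]
      omega
    exact ⟨hp, (h.word_iff h0 hp).1 hword, fun k _ => (hwt k).2 (hcard k)⟩
  · rintro ⟨hp, hL, hw⟩
    refine ⟨h.mem_sdiff_iff h0, fun i j j' hj _ hm => ?_, fun i i' j hi _ hm =>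
      h.lt_of_isPath h0 hp hi hm, fun k => (hwt k).1 ?_, (h.word_iff h0 hp).2 hL⟩
    · exact h.monotone ⟨le_rfl, hj⟩ (Finset.mem_sdiff.1 hm).1
    · rcases lt_or_ge k n with hk | hk
      · exact hw k hk
      · rw [rowLen_eq_zero_of_le hn hk, wt, hp.2 k hk, hp.2 (k + 1) (by omega)]
        simp

end Encodes

/-- The filling encoded by a chain of diagrams. -/
def fillingOf (C : ℕ → YoungDiagram) (c : ℕ × ℕ) : ℕ := sInf {k | c ∈ C k}

theorem IsPath.encodes {n : ℕ} {ν : YoungDiagram} {C : ℕ → YoungDiagram} (h : IsPath n ν C) :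
    Encodes ν (fillingOf C) C := by
  have hmono : Monotone C := monotone_nat_of_le_succ fun k => (h.1 k).le
  have hν : ∀ k, C k ≤ ν := fun k => (hmono (le_max_left k n)).trans (h.2 _ (le_max_right k n)).le
  refine ⟨fun k c => ⟨fun hc => ⟨hν k hc, Nat.sInf_le hc⟩, ?_⟩, fun c hc => ?_⟩
  · rintro ⟨hc, hk⟩
    refine hmono hk (Nat.sInf_mem (s := {k | c ∈ C k}) ⟨n, ?_⟩)
    rw [Set.mem_ofPred_eq, h.2 n le_rfl]
    exact hc
  · rw [fillingOf, Nat.sInf_eq_zero]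
    refine Or.inr (Set.eq_empty_of_forall_notMem fun k hk => hc (hν k hk))

/-- The chain of sublevel diagrams of a filling. -/
def chainOf (ν : YoungDiagram) (T : ℕ × ℕ → ℕ) (k : ℕ) : YoungDiagram :=
  if h : IsLowerSet (ν.cells.filter fun c => T c ≤ k : Set (ℕ × ℕ)) then ⟨_, h⟩ else ⊥

theorem IsLRTableau.encodes {lam μ ν : YoungDiagram} {T : ℕ × ℕ → ℕ}
    (h : IsLRTableau lam μ ν T) : Encodes ν T (chainOf ν T) := by
  have hz : ∀ c, c ∉ ν → T c = 0 := fun c hc => by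
    by_contra hT
    exact hc (Finset.mem_sdiff.1 ((h.1 c).2 hT)).1
  refine ⟨fun k c => ?_, hz⟩
  have hl : IsLowerSet (ν.cells.filter fun c => T c ≤ k : Set (ℕ × ℕ)) := by
    rintro ⟨i', j'⟩ ⟨i, j⟩ hle hc
    obtain ⟨hi, hj⟩ : i ≤ i' ∧ j ≤ j' := hle
    simp only [Finset.coe_filter, Set.mem_ofPred_eq, YoungDiagram.mem_cells] at hc ⊢
    have hν := ν.up_left_mem hi hj hc.1
    have hν' := ν.up_left_mem le_rfl hj hc.1
    refine ⟨hν, le_trans ?_ hc.2⟩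
    by_cases hlam : (i, j) ∈ lam
    · have : T (i, j) = 0 := by
        by_contra hT
        exact (Finset.mem_sdiff.1 ((h.1 _).2 hT)).2 hlam
      omega
    · have hm : (i, j) ∈ ν.cells \ lam.cells := Finset.mem_sdiff.2 ⟨hν, hlam⟩
      have hm' : (i', j) ∈ ν.cells \ lam.cells :=
        Finset.mem_sdiff.2 ⟨hν', fun hc => hlam (lam.up_left_mem hi le_rfl hc)⟩
      have hm'' : (i', j') ∈ ν.cells \ lam.cells :=
        Finset.mem_sdiff.2 ⟨hc.1, fun hc => hlam (lam.up_left_mem hi hj hc)⟩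
      refine le_trans ?_ (h.2.1 i' j j' hj hm' hm'')
      rcases hi.lt_or_eq with hi | rfl
      · exact (h.2.2.1 i i' j hi hm hm').le
      · rfl
  rw [chainOf, dif_pos hl, ← YoungDiagram.mem_cells]
  exact Finset.mem_filter

theorem IsLRTableau.chainOf_zero {lam μ ν : YoungDiagram} (hle : lam ≤ ν) {T : ℕ × ℕ → ℕ}
    (h : IsLRTableau lam μ ν T) : chainOf ν T 0 = lam := by
  refine YoungDiagram.ext (Finset.ext fun c => ?_)
  rw [YoungDiagram.mem_cells, YoungDiagram.mem_cells, h.encodes.mem_iff, Nat.le_zero]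
  have := h.1 c
  rw [Finset.mem_sdiff, YoungDiagram.mem_cells, YoungDiagram.mem_cells] at this
  have hc := @hle c
  tauto

theorem Encodes.filling_eq {ν : YoungDiagram} {T T' : ℕ × ℕ → ℕ} {C : ℕ → YoungDiagram}
    (h : Encodes ν T C) (h' : Encodes ν T' C) : T = T' := by
  funext c
  by_cases hc : c ∈ ν
  · refine le_antisymm ?_ ?_
    · exact ((h.mem_iff _ _).1 ((h'.mem_iff _ _).2 ⟨hc, le_rfl⟩)).2
    · exact ((h'.mem_iff _ _).1 ((h.mem_iff _ _).2 ⟨hc, le_rfl⟩)).2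
  · rw [h.eq_zero c hc, h'.eq_zero c hc]

theorem Encodes.chain_eq {ν : YoungDiagram} {T : ℕ × ℕ → ℕ} {C C' : ℕ → YoungDiagram}
    (h : Encodes ν T C) (h' : Encodes ν T C') : C = C' := by
  funext k
  refine YoungDiagram.ext (Finset.ext fun c => ?_)
  rw [YoungDiagram.mem_cells, YoungDiagram.mem_cells, h.mem_iff, h'.mem_iff]

theorem schurOp_single_apply {μ : YoungDiagram} {n : ℕ} (hn : μ.rowLen n = 0)
    (lam ν : YoungDiagram) : schurOp μ n (single lam) ν = lrCoeff lam μ ν := by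
  rw [schurOp_apply_eq_sum_latticePaths]
  simp only [single]
  rw [Finset.sum_boole, Nat.cast_inj, lrCoeff]
  split_ifs with hle
  · rw [← Nat.card_eq_finsetCard]
    refine Nat.card_congr ⟨fun C => ⟨fillingOf C.1, ?_⟩, fun T => ⟨chainOf ν T.1, ?_⟩, ?_, ?_⟩
    · obtain ⟨C, hC⟩ := C
      rw [Finset.mem_filter] at hC
      exact (((mem_latticePaths.1 hC.1).1.encodes.isLRTableau_iff hn).2 hC).1
    · rw [Finset.mem_filter]
      exact (T.2.encodes.isLRTableau_iff hn).1 ⟨T.2, T.2.chainOf_zero hle⟩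
    · rintro ⟨C, hC⟩
      rw [Finset.mem_filter] at hC
      have he := (mem_latticePaths.1 hC.1).1.encodes
      have hT := ((he.isLRTableau_iff hn).2 hC).1
      exact Subtype.ext (hT.encodes.chain_eq he)
    · rintro ⟨T, hT⟩
      have hC := (hT.encodes.isLRTableau_iff hn).1 ⟨hT, hT.chainOf_zero hle⟩
      exact Subtype.ext ((mem_latticePaths.1 hC.1).1.encodes.filling_eq hT.encodes)
  · rw [Finset.card_eq_zero, Finset.filter_eq_empty_iff]
    rintro C hC rfl
    have he := (mem_latticePaths.1 hC).1.encodes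
    exact hle fun c hc => ((he.mem_iff 0 c).1 hc).1

theorem conj_single (lam : YoungDiagram) : conj (single lam) = single lam.transpose := by
  funext ν
  rw [conj_apply, single, single]
  exact if_congr ⟨fun h => by rw [← h, YoungDiagram.transpose_transpose],
    fun h => by rw [h, YoungDiagram.transpose_transpose]⟩ rfl rfl

theorem schurOp_single_comm {lam μ : YoungDiagram} {m n : ℕ} (hm : lam.rowLen m = 0)
    (hn : μ.rowLen n = 0) : schurOp lam m (single μ) = schurOp μ n (single lam) := by
  have := LinearMap.congr_fun (schurOp_commute lam μ m n).eq (single ⊥)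
  simpa only [Module.End.mul_apply, schurOp_single_bot hm, schurOp_single_bot hn] using this

theorem lrCoeff_comm (lam μ ν : YoungDiagram) : lrCoeff lam μ ν = lrCoeff μ lam ν := by
  have hm := rowLen_colLen_zero lam
  have hn := rowLen_colLen_zero μ
  have := congrFun (schurOp_single_comm hm hn) ν
  rw [schurOp_single_apply hm, schurOp_single_apply hn, Nat.cast_inj] at this
  exact this.symm

theorem lrCoeff_transpose (lam μ ν : YoungDiagram) :
    lrCoeff lam.transpose μ.transpose ν.transpose = lrCoeff lam μ ν := by
  have hm := rowLen_colLen_zero lam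
  have hn := rowLen_colLen_zero μ
  have hn' := rowLen_colLen_zero μ.transpose
  have hbot : (⊥ : YoungDiagram).transpose = ⊥ := ext_rowLen fun i => by
    rw [rowLen_bot, YoungDiagram.rowLen_transpose]
    by_contra h
    exact YoungDiagram.notMem_bot _ (YoungDiagram.mem_iff_lt_colLen.2 (Nat.pos_of_ne_zero h))
  have := LinearMap.congr_fun
    (schurOp_commute_conj lam μ.transpose (lam.colLen 0) (μ.transpose.colLen 0)).eq (single ⊥)
  simp only [Module.End.mul_apply, conj_single, hbot, schurOp_single_bot hm,
    schurOp_single_bot hn', YoungDiagram.transpose_transpose] at this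
  rw [schurOp_single_comm hm hn] at this
  have := congrFun this ν
  rw [schurOp_single_apply hn, conj_apply, schurOp_single_apply hn', Nat.cast_inj] at this
  exact this.symm

theorem le_of_lrCoeff_ne_zero {lam μ ν : YoungDiagram} (h : lrCoeff lam μ ν ≠ 0) : lam ≤ ν := by
  by_contra hle
  exact h (if_neg hle)

theorem card_sdiff_of_lrCoeff_ne_zero {lam μ ν : YoungDiagram} (h : lrCoeff lam μ ν ≠ 0) :
    (ν.cells \ lam.cells).card = μ.card := by
  have hle := le_of_lrCoeff_ne_zero h
  have hn := rowLen_colLen_zero μ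
  rw [lrCoeff, if_pos hle] at h
  obtain ⟨T, hT⟩ := (Nat.card_ne_zero.1 h).1
  have hC := (hT.encodes.isLRTableau_iff hn).1 ⟨hT, hT.chainOf_zero hle⟩
  obtain ⟨hp, -, hw⟩ := mem_latticePaths.1 hC.1
  have hsum : ∑ k ∈ Finset.range (μ.colLen 0), wt (chainOf ν T) k = ν.card - lam.card := by
    have := Finset.sum_range_sub (fun k => ((chainOf ν T k).card : ℤ)) (μ.colLen 0)
    rw [hp.2 _ le_rfl, hC.2] at this
    exact this
  rw [Finset.sum_congr rfl fun k hk => hw k (Finset.mem_range.1 hk), ← Nat.cast_sum,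
    ← card_eq_sum_rowLen hn] at hsum
  have hsub := YoungDiagram.cells_subset_iff.2 hle
  rw [Finset.card_sdiff_of_subset hsub]
  change ν.card - lam.card = _
  omega

theorem hookProd_transpose (ν : YoungDiagram) : hookProd ν.transpose = hookProd ν := by
  refine Finset.prod_nbij' Prod.swap Prod.swap ?_ ?_ (fun _ _ => Prod.swap_swap _)
    (fun _ _ => Prod.swap_swap _) fun c _ => ?_
  · intro c hc
    rw [YoungDiagram.mem_cells, YoungDiagram.mem_transpose] at hc
    exact hc
  · intro c hc
    rw [YoungDiagram.mem_cells, YoungDiagram.mem_transpose, Prod.swap_swap]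
    exact hc
  · rw [YoungDiagram.rowLen_transpose, YoungDiagram.colLen_transpose, Prod.fst_swap, Prod.snd_swap]
    congr 1
    omega

theorem skewContPoly_neg_transpose (e : ℚ) (ρ σ : YoungDiagram) :
    skewContPoly (-e) ρ.transpose σ.transpose =
      (-1) ^ (ρ.cells \ σ.cells).card * skewContPoly e ρ σ := by
  rw [skewContPoly, skewContPoly, ← Finset.prod_const, ← Finset.prod_mul_distrib]
  refine Finset.prod_nbij' Prod.swap Prod.swap ?_ ?_ (fun _ _ => Prod.swap_swap _)
    (fun _ _ => Prod.swap_swap _) fun c _ => ?_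
  · intro c hc
    simpa [YoungDiagram.mem_transpose] using hc
  · intro c hc
    simpa [YoungDiagram.mem_transpose] using hc
  · rw [Prod.fst_swap, Prod.snd_swap]
    ring

/-- Symmetry: `P_{λ,μ}(e,f) = (−1)^{|λ|+|μ|} P_{λ*,μ*}(−e,−f)`. -/
theorem P_conj_symm (lam mu : YoungDiagram) (e f : ℚ) :
    P lam mu e f =
      (-1 : ℚ) ^ (lam.card + mu.card) * P lam.transpose mu.transpose (-e) (-f) := by
  rw [P, P, ← smul_eq_mul (a := (-1 : ℚ) ^ _), smul_finsum, Eq.comm,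
    ← finsum_comp_equiv YoungDiagram.transposeOrderIso.toEquiv]
  refine finsum_congr fun ν => Eq.symm ?_
  change _ = (-1 : ℚ) ^ (lam.card + mu.card) •
    ((lrCoeff lam.transpose.transpose mu.transpose ν.transpose.transpose : ℚ) *
      skewContPoly (-e) ν.transpose lam.transpose *
      skewContPoly (-f) ν.transpose.transpose mu.transpose / hookProd ν.transpose)
  rw [hookProd_transpose, skewContPoly_neg_transpose, skewContPoly_neg_transpose, smul_eq_mul,
    YoungDiagram.transpose_transpose, YoungDiagram.transpose_transpose]
  have hlr : lrCoeff lam mu.transpose ν = lrCoeff lam.transpose mu ν.transpose := by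
    rw [← lrCoeff_transpose lam, YoungDiagram.transpose_transpose]
  rw [hlr]
  by_cases h : lrCoeff lam.transpose mu ν.transpose = 0
  · simp [h]
  · rw [card_sdiff_of_lrCoeff_ne_zero (hlr ▸ h : lrCoeff lam mu.transpose ν ≠ 0),
      card_sdiff_of_lrCoeff_ne_zero (lrCoeff_comm _ _ _ ▸ h : lrCoeff mu lam.transpose _ ≠ 0),
      card_transpose, card_transpose, pow_add]
    have h1 : ((-1 : ℚ) ^ lam.card) * (-1) ^ lam.card = 1 := by rw [← mul_pow]; norm_num
    have h2 : ((-1 : ℚ) ^ mu.card) * (-1) ^ mu.card = 1 := by rw [← mul_pow]; norm_num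
    set X := (lrCoeff lam.transpose mu ν.transpose : ℚ) * skewContPoly e ν lam *
      skewContPoly f ν.transpose mu / hookProd ν
    linear_combination -(X * ((-1) ^ mu.card * (-1) ^ mu.card)) * h1 - X * h2

end ChernTensor
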